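/- arXiv:1309.5512 — 7 statements merged into one kernel-verified Lean document; each statement's English description precedes it below -/
import Mathlib

section
/- Let a_1, a_2, a_3 be nonzero complex numbers, let τ : ℤ³ × ℝ → ℂ be nowhere vanishing, smooth in x, and satisfy the semi-discrete KP equation, and let φ : ℤ³ × ℝ → ℂ be smooth in x and satisfy the differential-difference equations φ_x = a_i φ_i + ((τ_x/τ)_i − τ_x/τ − a_i)φ for each i = 1,2,3. Then φ automatically satisfies the discrete linear system of the Hirota–Miwa equation: a_i φ_i − a_j φ_j = (a_i − a_j)(τ_{ij}τ/(τ_i τ_j))φ for all 1 ≤ i < j ≤ 3. -/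
noncomputable section

/-- Forward shift in the `i`-th discrete direction of `ℤ³`. -/
def fwd (i : Fin 3) (n : Fin 3 → ℤ) : Fin 3 → ℤ := Function.update n i (n i + 1)

/-- If `τ` is nowhere vanishing, smooth in `x`, satisfies the semi-discrete KP equation, and
`φ` is smooth in `x` and satisfies the differential-difference equations
`φ_x = a_i φ_i + ((τ_x/τ)_i − τ_x/τ − a_i) φ` for `i = 1,2,3`, then `φ` automatically satisfies
the discrete linear system `a_i φ_i − a_j φ_j = (a_i − a_j) (τ_{ij} τ / (τ_i τ_j)) φ` of the
Hirota–Miwa equation, for all `1 ≤ i < j ≤ 3`. -/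
theorem forward_diff_implies_discrete_linear_system
    (a : Fin 3 → ℂ) (ha : ∀ i, a i ≠ 0)
    (τ φ : (Fin 3 → ℤ) → ℝ → ℂ)
    (hτ0 : ∀ n x, τ n x ≠ 0)
    (hτsmooth : ∀ n, ContDiff ℝ (⊤ : ℕ∞) (τ n))
    (hφsmooth : ∀ n, ContDiff ℝ (⊤ : ℕ∞) (φ n))
    (hKP : ∀ i j : Fin 3, i < j → ∀ n x,
      (a i - a j) * (τ (fwd i (fwd j n)) x * τ n x - τ (fwd i n) x * τ (fwd j n) x)
        + deriv (τ (fwd i n)) x * τ (fwd j n) x - τ (fwd i n) x * deriv (τ (fwd j n)) x = 0)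
    (hlin : ∀ i : Fin 3, ∀ n x,
      deriv (φ n) x = a i * φ (fwd i n) x
        + (deriv (τ (fwd i n)) x / τ (fwd i n) x - deriv (τ n) x / τ n x - a i) * φ n x) :
    ∀ i j : Fin 3, i < j → ∀ n x,
      a i * φ (fwd i n) x - a j * φ (fwd j n) x
        = (a i - a j) * (τ (fwd i (fwd j n)) x * τ n x / (τ (fwd i n) x * τ (fwd j n) x))
            * φ n x := by
  intro i j hij n x
  have hi := hτ0 (fwd i n) x
  have hj := hτ0 (fwd j n) x
  have hcoef : (a i - a j) * (τ (fwd i (fwd j n)) x * τ n x / (τ (fwd i n) x * τ (fwd j n) x))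
      = a i - a j - deriv (τ (fwd i n)) x / τ (fwd i n) x
        + deriv (τ (fwd j n)) x / τ (fwd j n) x := by
    field_simp
    linear_combination hKP i j hij n x
  rw [hcoef]
  linear_combination hlin j n x - hlin i n x
end
end

section
/- Let a_1, a_2, a_3 be nonzero complex numbers, let τ : ℤ³ × ℝ → ℂ be nowhere vanishing, smooth in x, and satisfy the semi-discrete KP equation, and let ψ : ℤ³ × ℝ → ℂ be smooth in x and satisfy the differential-difference equations ψ_x = −a_i ψ_ī + ((τ_x/τ)_ī − τ_x/τ + a_i)ψ for each i = 1,2,3. Then ψ automatically satisfies the backward discrete linear system of the Hirota–Miwa equation: a_i ψ_ī − a_j ψ_j̄ = (a_i − a_j)(τ_{īj̄}τ/(τ_ī τ_j̄))ψ for all 1 ≤ i < j ≤ 3. -/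
noncomputable section

/-- Backward shift in the `i`-th discrete direction of `ℤ³`. -/
def bwd (i : Fin 3) (n : Fin 3 → ℤ) : Fin 3 → ℤ := Function.update n i (n i - 1)

theorem fwd_bwd (i : Fin 3) (n : Fin 3 → ℤ) : fwd i (bwd i n) = n := by
  simp [fwd, bwd]

theorem bwd_comm {i j : Fin 3} (hij : i ≠ j) (n : Fin 3 → ℤ) :
    bwd i (bwd j n) = bwd j (bwd i n) := by
  simp only [bwd, Function.update_of_ne hij, Function.update_of_ne hij.symm]
  exact Function.update_comm hij.symm _ _ n

/-- If `τ` is nowhere vanishing, smooth in `x`, satisfies the semi-discrete KP equation, and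
`ψ` is smooth in `x` and satisfies the differential-difference equations
`ψ_x = −a_i ψ_ī + ((τ_x/τ)_ī − τ_x/τ + a_i) ψ` for `i = 1,2,3`, then `ψ` automatically satisfies
the backward discrete linear system `a_i ψ_ī − a_j ψ_j̄ = (a_i − a_j)(τ_{īj̄} τ/(τ_ī τ_j̄)) ψ`
of the Hirota–Miwa equation, for all `1 ≤ i < j ≤ 3`. -/
theorem backward_diff_implies_discrete_linear_system
    (a : Fin 3 → ℂ) (ha : ∀ i, a i ≠ 0)
    (τ ψ : (Fin 3 → ℤ) → ℝ → ℂ)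
    (hτ0 : ∀ n x, τ n x ≠ 0)
    (hτsmooth : ∀ n, ContDiff ℝ (⊤ : ℕ∞) (τ n))
    (hψsmooth : ∀ n, ContDiff ℝ (⊤ : ℕ∞) (ψ n))
    (hKP : ∀ i j : Fin 3, i < j → ∀ n x,
      (a i - a j) * (τ (fwd i (fwd j n)) x * τ n x - τ (fwd i n) x * τ (fwd j n) x)
        + deriv (τ (fwd i n)) x * τ (fwd j n) x - τ (fwd i n) x * deriv (τ (fwd j n)) x = 0)
    (hlin : ∀ i : Fin 3, ∀ n x,
      deriv (ψ n) x = -(a i) * ψ (bwd i n) x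
        + (deriv (τ (bwd i n)) x / τ (bwd i n) x - deriv (τ n) x / τ n x + a i) * ψ n x) :
    ∀ i j : Fin 3, i < j → ∀ n x,
      a i * ψ (bwd i n) x - a j * ψ (bwd j n) x
        = (a i - a j) * (τ (bwd i (bwd j n)) x * τ n x / (τ (bwd i n) x * τ (bwd j n) x))
            * ψ n x := by
  intro i j hij n x
  have h1 : fwd i (bwd i (bwd j n)) = bwd j n := fwd_bwd i _
  have h2 : fwd j (bwd i (bwd j n)) = bwd i n := by
    rw [bwd_comm hij.ne, fwd_bwd]
  have hK := hKP i j hij (bwd i (bwd j n)) x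
  rw [h2, h1, fwd_bwd] at hK
  have hi := hlin i n x
  have hj := hlin j n x
  have hi0 := hτ0 (bwd i n) x
  have hj0 := hτ0 (bwd j n) x
  have key : deriv (τ (bwd i n)) x / τ (bwd i n) x - deriv (τ (bwd j n)) x / τ (bwd j n) x
      + (a i - a j)
      = (a i - a j) * (τ (bwd i (bwd j n)) x * τ n x / (τ (bwd i n) x * τ (bwd j n) x)) := by
    field_simp
    linear_combination -hK
  rw [← key]
  linear_combination hi - hj
end
end

section
/- (Darboux transformation for the Hirota–Miwa equation.) Let a_1, a_2, a_3 be nonzero complex numbers and let τ : ℤ³ × ℝ → ℂ be nowhere vanishing, smooth in x, and satisfy the semi-discrete KP equation. Let θ and φ be smooth solutions of the forward linear system with potential τ, with θ nowhere vanishing. Define τ̃ := θτ and φ̃ := φ_x − (θ_x/θ)φ. Then: (a) for each i = 1,2,3, φ̃ = a_i(φ_i − (θ_i/θ)φ); (b) τ̃ is nowhere vanishing and satisfies the semi-discrete KP equation; (c) φ̃ satisfies the forward linear system with potential τ̃, i.e. a_i φ̃_i − a_j φ̃_j = (a_i − a_j)(τ̃_{ij}τ̃/(τ̃_i τ̃_j))φ̃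 for 1 ≤ i < j ≤ 3 and φ̃_x = a_i φ̃_i + ((τ̃_x/τ̃)_i − τ̃_x/τ̃ − a_i)φ̃ for i = 1,2,3. -/
noncomputable section

/-- The semi-discrete KP equation:
`(a_i − a_j)(τ_{ij}τ − τ_i τ_j) + τ_{i,x} τ_j − τ_i τ_{j,x} = 0` for all `1 ≤ i < j ≤ 3`. -/
def SemiKP (a : Fin 3 → ℂ) (τ : (Fin 3 → ℤ) → ℝ → ℂ) : Prop :=
  ∀ i j : Fin 3, i < j → ∀ n x,
    (a i - a j) * (τ (fwd i (fwd j n)) x * τ n x - τ (fwd i n) x * τ (fwd j n) x)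
      + deriv (τ (fwd i n)) x * τ (fwd j n) x - τ (fwd i n) x * deriv (τ (fwd j n)) x = 0

/-- The forward linear system for `φ` with potential `τ`:
`a_i φ_i − a_j φ_j = (a_i − a_j)(τ_{ij}τ/(τ_i τ_j))φ` for `1 ≤ i < j ≤ 3`, together with
`φ_x = a_i φ_i + ((τ_x/τ)_i − τ_x/τ − a_i)φ` for `i = 1,2,3`. -/
def FwdLin (a : Fin 3 → ℂ) (τ φ : (Fin 3 → ℤ) → ℝ → ℂ) : Prop :=
  (∀ i j : Fin 3, i < j → ∀ n x,
    a i * φ (fwd i n) x - a j * φ (fwd j n) x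
      = (a i - a j) * (τ (fwd i (fwd j n)) x * τ n x / (τ (fwd i n) x * τ (fwd j n) x))
          * φ n x)
  ∧ ∀ i : Fin 3, ∀ n x,
      deriv (φ n) x = a i * φ (fwd i n) x
        + (deriv (τ (fwd i n)) x / τ (fwd i n) x - deriv (τ n) x / τ n x - a i) * φ n x

/-- The backward linear system for `ψ` with potential `τ`:
`a_i ψ_ī − a_j ψ_j̄ = (a_i − a_j)(τ_{īj̄}τ/(τ_ī τ_j̄))ψ` for `1 ≤ i < j ≤ 3`, together with
`ψ_x = −a_i ψ_ī + ((τ_x/τ)_ī − τ_x/τ + a_i)ψ` for `i = 1,2,3`. -/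
def BwdLin (a : Fin 3 → ℂ) (τ ψ : (Fin 3 → ℤ) → ℝ → ℂ) : Prop :=
  (∀ i j : Fin 3, i < j → ∀ n x,
    a i * ψ (bwd i n) x - a j * ψ (bwd j n) x
      = (a i - a j) * (τ (bwd i (bwd j n)) x * τ n x / (τ (bwd i n) x * τ (bwd j n) x))
          * ψ n x)
  ∧ ∀ i : Fin 3, ∀ n x,
      deriv (ψ n) x = -(a i) * ψ (bwd i n) x
        + (deriv (τ (bwd i n)) x / τ (bwd i n) x - deriv (τ n) x / τ n x + a i) * ψ n x

theorem fwd_comm {i j : Fin 3} (hij : i ≠ j) (n : Fin 3 → ℤ) :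
    fwd i (fwd j n) = fwd j (fwd i n) := by
  simp only [fwd, Function.update_of_ne hij, Function.update_of_ne hij.symm]
  exact Function.update_comm hij.symm _ _ _

namespace FwdLin

variable {a : Fin 3 → ℂ} {τ θ φ : (Fin 3 → ℤ) → ℝ → ℂ}

/-- The Darboux transform of `φ` by `θ`, with the `x`-derivatives eliminated in favour of the
shift in direction `i`. -/
theorem deriv_sub_logDeriv_mul (hθ : FwdLin a τ θ) (hφ : FwdLin a τ φ) (hθ0 : ∀ n x, θ n x ≠ 0)
    (i : Fin 3) (n : Fin 3 → ℤ) (x : ℝ) :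
    deriv (φ n) x - deriv (θ n) x / θ n x * φ n x
      = a i * (φ (fwd i n) x - θ (fwd i n) x / θ n x * φ n x) := by
  have h := hθ0 n x
  rw [hφ.2 i n x, hθ.2 i n x, add_div, mul_div_cancel_right₀ _ h]
  ring

theorem deriv_mul_potential (hθ : FwdLin a τ θ) (hτ0 : ∀ n x, τ n x ≠ 0)
    (hτ : ∀ n, Differentiable ℝ (τ n)) (hθd : ∀ n, Differentiable ℝ (θ n))
    (i : Fin 3) (n : Fin 3 → ℤ) (x : ℝ) :
    deriv (fun x => θ n x * τ n x) x
      = τ n x * (a i * θ (fwd i n) x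
        + (deriv (τ (fwd i n)) x / τ (fwd i n) x - a i) * θ n x) := by
  rw [deriv_fun_mul (hθd n x) (hτ n x), hθ.2 i n x]
  have := hτ0 n x
  have := hτ0 (fwd i n) x
  field_simp
  ring

/-- Multiplying a potential by a solution of its forward linear system gives a solution of the
semi-discrete KP equation. -/
theorem semiKP_mul (hθ : FwdLin a τ θ) (hτ0 : ∀ n x, τ n x ≠ 0)
    (hτ : ∀ n, Differentiable ℝ (τ n)) (hθd : ∀ n, Differentiable ℝ (θ n)) :
    SemiKP a (fun n x => θ n x * τ n x) := by
  intro i j hij n x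
  have hi := hθ.deriv_mul_potential hτ0 hτ hθd j (fwd i n) x
  have hj := hθ.deriv_mul_potential hτ0 hτ hθd i (fwd j n) x
  rw [← fwd_comm hij.ne] at hi
  have hl := hθ.1 i j hij n x
  have hτi := hτ0 (fwd i n) x
  have hτj := hτ0 (fwd j n) x
  rw [mul_div_assoc', div_mul_eq_mul_div, eq_div_iff (mul_ne_zero hτi hτj)] at hl
  simp only [hi, hj]
  linear_combination -θ (fwd i (fwd j n)) x * hl

theorem darboux_shift (hθ : FwdLin a τ θ) (hφ : FwdLin a τ φ) (hτ0 : ∀ n x, τ n x ≠ 0)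
    (hθ0 : ∀ n x, θ n x ≠ 0) {i j : Fin 3} (hij : i < j) (n : Fin 3 → ℤ) (x : ℝ) :
    a i * (deriv (φ (fwd i n)) x - deriv (θ (fwd i n)) x / θ (fwd i n) x * φ (fwd i n) x)
        - a j * (deriv (φ (fwd j n)) x - deriv (θ (fwd j n)) x / θ (fwd j n) x * φ (fwd j n) x)
      = (a i - a j) * (θ (fwd i (fwd j n)) x * τ (fwd i (fwd j n)) x * (θ n x * τ n x)
          / (θ (fwd i n) x * τ (fwd i n) x * (θ (fwd j n) x * τ (fwd j n) x)))
        * (deriv (φ n) x - deriv (θ n) x / θ n x * φ n x) := by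
  have hi := hθ.deriv_sub_logDeriv_mul hφ hθ0 i n x
  have hj := hθ.deriv_sub_logDeriv_mul hφ hθ0 j n x
  rw [hθ.deriv_sub_logDeriv_mul hφ hθ0 j (fwd i n) x,
    hθ.deriv_sub_logDeriv_mul hφ hθ0 i (fwd j n) x, ← fwd_comm hij.ne]
  generalize deriv (φ n) x - deriv (θ n) x / θ n x * φ n x = D at hi hj ⊢
  have hl := hθ.1 i j hij n x
  have h0 := hθ0 n x
  have hθi := hθ0 (fwd i n) x
  have hθj := hθ0 (fwd j n) x
  have hcoef : (a i - a j) * (θ (fwd i (fwd j n)) x * τ (fwd i (fwd j n)) x * (θ n x * τ n x)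
        / (θ (fwd i n) x * τ (fwd i n) x * (θ (fwd j n) x * τ (fwd j n) x)))
      = θ (fwd i (fwd j n)) x / (θ (fwd i n) x * θ (fwd j n) x)
        * (a i * θ (fwd i n) x - a j * θ (fwd j n) x) := by
    rw [hl]
    have := hτ0 (fwd i n) x
    have := hτ0 (fwd j n) x
    field_simp
  have hD : (a i * θ (fwd i n) x - a j * θ (fwd j n) x) * D
      = a i * a j * (θ (fwd i n) x * φ (fwd j n) x - θ (fwd j n) x * φ (fwd i n) x) := by
    linear_combination a i * θ (fwd i n) x * hj - a j * θ (fwd j n) x * hi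
  rw [hcoef, mul_assoc, hD]
  field_simp
  ring

theorem darboux_deriv (hθ : FwdLin a τ θ) (hφ : FwdLin a τ φ) (hτ0 : ∀ n x, τ n x ≠ 0)
    (hθ0 : ∀ n x, θ n x ≠ 0) (hτ : ∀ n, Differentiable ℝ (τ n))
    (hθd : ∀ n, Differentiable ℝ (θ n)) (hφd : ∀ n, Differentiable ℝ (φ n))
    (i : Fin 3) (n : Fin 3 → ℤ) (x : ℝ) :
    deriv (fun x => deriv (φ n) x - deriv (θ n) x / θ n x * φ n x) x
      = a i * (deriv (φ (fwd i n)) x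
          - deriv (θ (fwd i n)) x / θ (fwd i n) x * φ (fwd i n) x)
        + (deriv (fun x => θ (fwd i n) x * τ (fwd i n) x) x / (θ (fwd i n) x * τ (fwd i n) x)
            - deriv (fun x => θ n x * τ n x) x / (θ n x * τ n x) - a i)
          * (deriv (φ n) x - deriv (θ n) x / θ n x * φ n x) := by
  have h0 := hθ0 n x
  have hi0 := hθ0 (fwd i n) x
  have hlog : ∀ m, deriv (fun x => θ m x * τ m x) x / (θ m x * τ m x)
      = deriv (θ m) x / θ m x + deriv (τ m) x / τ m x := fun m => by
    rw [deriv_fun_mul (hθd m x) (hτ m x)]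
    have := hθ0 m x
    have := hτ0 m x
    field_simp
  have hder : deriv (fun x => deriv (φ n) x - deriv (θ n) x / θ n x * φ n x) x
      = a i * (deriv (φ (fwd i n)) x
        - ((deriv (θ (fwd i n)) x * θ n x - θ (fwd i n) x * deriv (θ n) x) / θ n x ^ 2 * φ n x
          + θ (fwd i n) x / θ n x * deriv (φ n) x)) := by
    simp only [fun y => hθ.deriv_sub_logDeriv_mul hφ hθ0 i n y]
    exact (((hφd _ x).hasDerivAt.sub ((((hθd _ x).hasDerivAt.div (hθd n x).hasDerivAt h0)).mul
      (hφd n x).hasDerivAt)).const_mul (a i)).deriv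
  have hU : deriv (θ n) x / θ n x = a i * θ (fwd i n) x / θ n x
      + (deriv (τ (fwd i n)) x / τ (fwd i n) x - deriv (τ n) x / τ n x - a i) := by
    rw [hθ.2 i n x]
    field_simp
  have hcoef : deriv (θ (fwd i n)) x / θ (fwd i n) x + deriv (τ (fwd i n)) x / τ (fwd i n) x
        - (deriv (θ n) x / θ n x + deriv (τ n) x / τ n x) - a i
      = deriv (θ (fwd i n)) x / θ (fwd i n) x - a i * θ (fwd i n) x / θ n x := by
    linear_combination -hU
  have hmul : deriv (θ (fwd i n)) x / θ (fwd i n) x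
        * (deriv (φ n) x - deriv (θ n) x / θ n x * φ n x)
      = a i * (deriv (θ (fwd i n)) x / θ (fwd i n) x * φ (fwd i n) x
        - deriv (θ (fwd i n)) x / θ n x * φ n x) := by
    rw [hθ.deriv_sub_logDeriv_mul hφ hθ0 i n x]
    field_simp
  rw [hder, hlog, hlog, hcoef, sub_mul (deriv (θ (fwd i n)) x / _) (_ / _), hmul]
  field_simp
  ring

end FwdLin

/-- Darboux transformation for the Hirota–Miwa equation: given a nowhere-vanishing
solution `θ` and solution `φ` of the forward linear system with potential `τ`, the
functions `τ̃ = θτ` and `φ̃ = φ_x − (θ_x/θ)φ` satisfy: (a) `φ̃ = a_i(φ_i − (θ_i/θ)φ)` for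
each `i`; (b) `τ̃` is nowhere vanishing and satisfies the semi-discrete KP equation;
(c) `φ̃` satisfies the forward linear system with potential `τ̃`. -/
theorem darboux_hirota_miwa
    (a : Fin 3 → ℂ) (ha : ∀ i, a i ≠ 0)
    (τ θ φ : (Fin 3 → ℤ) → ℝ → ℂ)
    (hτ0 : ∀ n x, τ n x ≠ 0)
    (hτsmooth : ∀ n, ContDiff ℝ (⊤ : ℕ∞) (τ n))
    (hKP : SemiKP a τ)
    (hθsmooth : ∀ n, ContDiff ℝ (⊤ : ℕ∞) (θ n))
    (hφsmooth : ∀ n, ContDiff ℝ (⊤ : ℕ∞) (φ n))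
    (hθ : FwdLin a τ θ) (hφ : FwdLin a τ φ)
    (hθ0 : ∀ n x, θ n x ≠ 0) :
    (∀ i : Fin 3, ∀ n x,
      deriv (φ n) x - deriv (θ n) x / θ n x * φ n x
        = a i * (φ (fwd i n) x - θ (fwd i n) x / θ n x * φ n x))
    ∧ (∀ n x, θ n x * τ n x ≠ 0)
    ∧ SemiKP a (fun n x => θ n x * τ n x)
    ∧ FwdLin a (fun n x => θ n x * τ n x)
        (fun n x => deriv (φ n) x - deriv (θ n) x / θ n x * φ n x) := by
  have hτ n := (hτsmooth n).differentiable (by simp)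
  have hθd n := (hθsmooth n).differentiable (by simp)
  have hφd n := (hφsmooth n).differentiable (by simp)
  exact ⟨hθ.deriv_sub_logDeriv_mul hφ hθ0, fun n x => mul_ne_zero (hθ0 n x) (hτ0 n x),
    hθ.semiKP_mul hτ0 hτ hθd, fun i j hij n x => hθ.darboux_shift hφ hτ0 hθ0 hij n x,
    hθ.darboux_deriv hφ hτ0 hθ0 hτ hθd hφd⟩
end
end

section
/- (N-fold Darboux transformation in Wronskian form.) Let a_1, a_2, a_3 be nonzero complex numbers, let τ : ℤ³ × ℝ → ℂ be nowhere vanishing, smooth in x, and satisfy the semi-discrete KP equation, and let θ_1, …, θ_N and φ be smooth solutions of the forward linear system with potential τ. Let W(n,x) := det(∂_x^{r−1}θ_s(n,x))_{r,s=1,…,N} be the Wronskian and assume W is nowhere zero. Then: (a) τ[N] := W·τ and φ[N] := Ŵ/W, where Ŵ is the (N+1)×(N+1) Wronskian determinant of θ_1,…,θ_N,φ, satisfy the forward linear system with potential τ[N] (and τ[N] satisfies the semi-discrete KP equation); (b) for each k = 1,2,3, W(n,x) = a_k^{N(N−1)/2} · det(θ_s(n+(r−1)e_k, x))_{r,s=1,…,N}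 and Ŵ(n,x) = a_k^{N(N+1)/2} · det of the (N+1)×(N+1) matrix whose (r,s) entry is θ_s(n+(r−1)e_k,x) for s ≤ N and φ(n+(r−1)e_k,x) for s = N+1; i.e. the Wronskian expressions equal the corresponding Casoratian expressions in each lattice direction. -/
noncomputable section

/-- The Wronskian determinant `det(∂_x^{r-1} θ_s)` of `N` functions, at lattice point `n`
and continuous variable `x`. -/
def Wr {N : ℕ} (θ : Fin N → (Fin 3 → ℤ) → ℝ → ℂ) (n : Fin 3 → ℤ) (x : ℝ) : ℂ :=
  Matrix.det (Matrix.of fun r s : Fin N => deriv^[(r : ℕ)] (θ s n) x)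

/-- The Casoratian determinant `det(θ_s(n + (r-1)e_k, x))` of `N` functions, with forward
shifts in the lattice direction `k`. -/
def Cas {N : ℕ} (k : Fin 3) (θ : Fin N → (Fin 3 → ℤ) → ℝ → ℂ) (n : Fin 3 → ℤ) (x : ℝ) : ℂ :=
  Matrix.det (Matrix.of fun r s : Fin N => θ s ((fwd k)^[(r : ℕ)] n) x)

/-- `P` is a linear ordinary differential operator of order less than `m` with smooth
coefficients. -/
def OrderLT (m : ℕ) (P : (ℝ → ℂ) → ℝ → ℂ) : Prop :=
  ∃ c : ℕ → ℝ → ℂ, (∀ j, ContDiff ℝ (⊤ : ℕ∞) (c j)) ∧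
    ∀ f, ContDiff ℝ (⊤ : ℕ∞) f → ∀ x, P f x = ∑ j ∈ Finset.range m, c j x * deriv^[j] f x

namespace OrderLT

variable {m k : ℕ} {P Q : (ℝ → ℂ) → ℝ → ℂ}

lemma congr (hP : OrderLT m P)
    (h : ∀ f, ContDiff ℝ (⊤ : ℕ∞) f → ∀ x, Q f x = P f x) : OrderLT m Q := by
  obtain ⟨c, hc, hP⟩ := hP
  exact ⟨c, hc, fun f hf x => (h f hf x).trans (hP f hf x)⟩

lemma mono (hP : OrderLT m P) (hmk : m ≤ k) : OrderLT k P := by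
  obtain ⟨c, hc, hP⟩ := hP
  refine ⟨fun j => if j < m then c j else fun _ => 0, fun j => ?_, fun f hf x => ?_⟩
  · dsimp only
    split_ifs
    exacts [hc j, contDiff_const]
  · rw [hP f hf x, ← Finset.sum_subset (Finset.range_mono hmk)]
    · refine Finset.sum_congr rfl fun j hj => ?_
      simp only [if_pos (Finset.mem_range.1 hj)]
    · intro j _ hj
      simp only [if_neg (fun h => hj (Finset.mem_range.2 h)), zero_mul]

lemma add (hP : OrderLT m P) (hQ : OrderLT m Q) : OrderLT m (fun f x => P f x + Q f x) := by
  obtain ⟨c, hc, hP⟩ := hP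
  obtain ⟨d, hd, hQ⟩ := hQ
  refine ⟨fun j x => c j x + d j x, fun j => (hc j).add (hd j), fun f hf x => ?_⟩
  simp only [hP f hf x, hQ f hf x]
  rw [← Finset.sum_add_distrib]
  exact Finset.sum_congr rfl fun j _ => by ring

lemma mul_left {g : ℝ → ℂ} (hg : ContDiff ℝ (⊤ : ℕ∞) g) (hP : OrderLT m P) :
    OrderLT m (fun f x => g x * P f x) := by
  obtain ⟨c, hc, hP⟩ := hP
  refine ⟨fun j x => g x * c j x, fun j => hg.mul (hc j), fun f hf x => ?_⟩
  simp only [hP f hf x, Finset.mul_sum]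
  exact Finset.sum_congr rfl fun j _ => by ring

lemma iterate_deriv (m : ℕ) : OrderLT (m + 1) (fun f x => deriv^[m] f x) := by
  refine ⟨fun j _ => if j = m then 1 else 0, fun j => contDiff_const, fun f _ x => ?_⟩
  simp

lemma contDiff_apply (hP : OrderLT m P) {f : ℝ → ℂ} (hf : ContDiff ℝ (⊤ : ℕ∞) f) :
    ContDiff ℝ (⊤ : ℕ∞) (P f) := by
  obtain ⟨c, hc, hP⟩ := hP
  rw [funext (hP f hf)]
  exact ContDiff.sum fun j _ => (hc j).mul (hf.iterate_deriv j)

lemma sum {P : ℕ → (ℝ → ℂ) → ℝ → ℂ} (k : ℕ) (hP : ∀ j < k, OrderLT m (P j)) :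
    OrderLT m (fun f x => ∑ j ∈ Finset.range k, P j f x) := by
  induction k with
  | zero => exact ⟨fun _ _ => 0, fun _ => contDiff_const, fun f _ x => by simp⟩
  | succ k ih =>
    simp only [Finset.sum_range_succ]
    exact (ih fun j hj => hP j (by omega)).add (hP k (by omega))

lemma deriv_comp (hP : OrderLT m P) : OrderLT (m + 1) (fun f => deriv (P f)) := by
  obtain ⟨c, hc, hP⟩ := hP
  have hc' : ∀ j, ContDiff ℝ (⊤ : ℕ∞) (deriv (c j)) := fun j => (hc j).iterate_deriv 1
  refine OrderLT.congr (sum m fun j hj => OrderLT.add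
    (OrderLT.mul_left (hc' j) ((iterate_deriv j).mono (show j + 1 ≤ m + 1 by omega)))
    (OrderLT.mul_left (hc j) ((iterate_deriv (j + 1)).mono (by omega)))) ?_
  intro f hf x
  rw [funext (hP f hf)]
  have hd : ∀ {g : ℝ → ℂ}, ContDiff ℝ (⊤ : ℕ∞) g → DifferentiableAt ℝ g x :=
    fun hg => (hg.differentiable (by simp)) x
  rw [deriv_fun_sum fun j _ => (hd ((hc j).mul (hf.iterate_deriv j)))]
  refine Finset.sum_congr rfl fun j _ => ?_
  rw [deriv_fun_mul (hd (hc j)) (hd (hf.iterate_deriv j)), Function.iterate_succ_apply']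

end OrderLT

/-- The composite `(∂ - u (r-1)) ⋯ (∂ - u 1) (∂ - u 0)` applied to `f`. -/
def factoredOp (u : ℕ → ℝ → ℂ) : ℕ → (ℝ → ℂ) → ℝ → ℂ
  | 0, f => f
  | r + 1, f => fun x => deriv (factoredOp u r f) x - u r x * factoredOp u r f x

lemma OrderLT.factoredOp_sub {u : ℕ → ℝ → ℂ} (hu : ∀ r, ContDiff ℝ (⊤ : ℕ∞) (u r)) (r : ℕ) :
    OrderLT r (fun f x => factoredOp u r f x - deriv^[r] f x) := by
  induction r with
  | zero => exact ⟨fun _ _ => 0, fun _ => contDiff_const, fun f _ x => by simp [factoredOp]⟩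
  | succ r ih =>
    have hneg : ContDiff ℝ (⊤ : ℕ∞) (fun x => -u r x) := (hu r).neg
    refine OrderLT.congr (ih.deriv_comp.add (OrderLT.mul_left hneg
      ((ih.mono (Nat.le_succ r)).add (OrderLT.iterate_deriv r)))) ?_
    intro f hf x
    have h1 : DifferentiableAt ℝ (deriv^[r] f) x :=
      (hf.iterate_deriv r).differentiable (by simp) x
    have h2 : DifferentiableAt ℝ (fun x => factoredOp u r f x - deriv^[r] f x) x :=
      (ih.contDiff_apply hf).differentiable (by simp) x
    have h3 : deriv (factoredOp u r f) x
        = deriv (fun x => factoredOp u r f x - deriv^[r] f x) x + deriv (deriv^[r] f) x := by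
      rw [← deriv_fun_add h2 h1]
      simp
    simp only [Function.iterate_succ_apply', factoredOp, h3]
    ring

lemma factoredOp_single (u f : ℝ → ℂ) (r : ℕ) :
    factoredOp (fun j => if j = 0 then u else 0) (r + 1) f
      = deriv^[r] (fun x => deriv f x - u x * f x) := by
  induction r with
  | zero => simp [factoredOp]
  | succ r ih =>
    rw [factoredOp, ih, Function.iterate_succ_apply']
    simp

lemma OrderLT.iterate_deriv_sub {u : ℝ → ℂ} (hu : ContDiff ℝ (⊤ : ℕ∞) u) (r : ℕ) :
    OrderLT (r + 1)
      (fun f x => deriv^[r] (fun x => deriv f x - u x * f x) x - deriv^[r + 1] f x) := by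
  refine (OrderLT.factoredOp_sub (u := fun j => if j = 0 then u else 0) (fun j => ?_)
    (r + 1)).congr fun f _ x => by rw [factoredOp_single]
  split_ifs
  exacts [hu, contDiff_const]

lemma contDiff_deriv_sub {u f : ℝ → ℂ} (hu : ContDiff ℝ (⊤ : ℕ∞) u)
    (hf : ContDiff ℝ (⊤ : ℕ∞) f) : ContDiff ℝ (⊤ : ℕ∞) (fun x => deriv f x - u x * f x) :=
  (hf.iterate_deriv 1).sub (hu.mul hf)

lemma OrderLT.comp_deriv_sub {m : ℕ} {P : (ℝ → ℂ) → ℝ → ℂ} {u : ℝ → ℂ} (hP : OrderLT m P)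
    (hu : ContDiff ℝ (⊤ : ℕ∞) u) :
    OrderLT (m + 1) (fun f => P (fun x => deriv f x - u x * f x)) := by
  obtain ⟨c, hc, hP⟩ := hP
  refine OrderLT.congr (OrderLT.sum m fun j hj => OrderLT.mul_left (hc j) (OrderLT.add
    ((OrderLT.iterate_deriv_sub hu j).mono (show j + 1 ≤ m + 1 by omega))
    ((OrderLT.iterate_deriv (j + 1)).mono (by omega)))) ?_
  intro f hf x
  rw [hP _ (contDiff_deriv_sub hu hf)]
  simp

/-- The Wronskian of finitely many functions of one variable. -/
def wronskian {N : ℕ} (g : Fin N → ℝ → ℂ) (x : ℝ) : ℂ :=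
  Matrix.det (Matrix.of fun r s : Fin N => deriv^[(r : ℕ)] (g s) x)

lemma det_eq_wronskian {N : ℕ} (g : Fin N → ℝ → ℂ) (hg : ∀ s, ContDiff ℝ (⊤ : ℕ∞) (g s))
    (Q : ℕ → (ℝ → ℂ) → ℝ → ℂ) (hQ : ∀ r, OrderLT r (fun f x => Q r f x - deriv^[r] f x))
    (x : ℝ) :
    Matrix.det (Matrix.of fun r s : Fin N => Q r (g s) x) = wronskian g x := by
  choose c _ hc using hQ
  let C : Matrix (Fin N) (Fin N) ℂ :=
    Matrix.of fun r j => (if j < r then c r j x else 0) + if j = r then 1 else 0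
  have hC : C.det = 1 := by
    rw [Matrix.det_of_isLowerTriangular]
    · simp [C]
    · intro r j hrj
      have hrj : r < j := hrj
      simp [C, hrj.not_gt, hrj.ne']
  have hmul : (Matrix.of fun r s : Fin N => Q r (g s) x)
      = C * Matrix.of fun r s : Fin N => deriv^[(r : ℕ)] (g s) x := by
    ext r s
    have h1 := hc r (g s) (hg s) x
    rw [sub_eq_iff_eq_add] at h1
    simp only [Matrix.mul_apply, Matrix.of_apply, C, add_mul, Finset.sum_add_distrib]
    rw [h1]
    congr 1
    · have h2 : ∀ j : Fin N, (if j < r then c r j x else 0) * deriv^[(j : ℕ)] (g s) x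
          = (fun j : ℕ => if j < (r : ℕ) then c r j x * deriv^[j] (g s) x else 0) j := by
        intro j
        simp only [Fin.val_fin_lt]
        split_ifs <;> simp
      rw [Finset.sum_congr rfl fun j _ => h2 j,
        Fin.sum_univ_eq_sum_range
          (fun j : ℕ => if j < (r : ℕ) then c r j x * deriv^[j] (g s) x else 0),
        ← Finset.sum_filter]
      refine Finset.sum_congr ?_ fun _ _ => rfl
      ext j
      have := r.isLt
      simp only [Finset.mem_range, Finset.mem_filter]
      omega
    · simp
  rw [hmul, Matrix.det_mul, hC, one_mul]
  rfl

lemma contDiff_det_iterate_deriv {N : ℕ} {g : Fin N → ℝ → ℂ}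
    (hg : ∀ s, ContDiff ℝ (⊤ : ℕ∞) (g s)) (p : Fin N → ℕ) :
    ContDiff ℝ (⊤ : ℕ∞)
      (fun x => Matrix.det (Matrix.of fun r s : Fin N => deriv^[p r] (g s) x)) := by
  simp only [Matrix.det_apply']
  exact ContDiff.sum fun σ _ => contDiff_const.mul
    (contDiff_prod fun i _ => (hg i).iterate_deriv _)

lemma contDiff_wronskian {N : ℕ} {g : Fin N → ℝ → ℂ}
    (hg : ∀ s, ContDiff ℝ (⊤ : ℕ∞) (g s)) : ContDiff ℝ (⊤ : ℕ∞) (wronskian g) :=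
  contDiff_det_iterate_deriv hg fun r => r

lemma contDiff_snoc {N : ℕ} {g : Fin N → ℝ → ℂ} {f : ℝ → ℂ}
    (hg : ∀ s, ContDiff ℝ (⊤ : ℕ∞) (g s)) (hf : ContDiff ℝ (⊤ : ℕ∞) f) (s : Fin (N + 1)) :
    ContDiff ℝ (⊤ : ℕ∞) ((Fin.snoc g f : Fin (N + 1) → ℝ → ℂ) s) := by
  induction s using Fin.lastCases with
  | last => simpa using hf
  | cast s => simpa using hg s

lemma OrderLT.wronskian_snoc {N : ℕ} {g : Fin N → ℝ → ℂ}
    (hg : ∀ s, ContDiff ℝ (⊤ : ℕ∞) (g s)) :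
    OrderLT N (fun f x => wronskian (Fin.snoc g f : Fin (N + 1) → ℝ → ℂ) x
      - wronskian g x * deriv^[N] f x) := by
  refine ⟨fun j x => (-1) ^ (j + N) * Matrix.det (Matrix.of fun r s : Fin N =>
    deriv^[((Fin.ofNat (N + 1) j).succAbove r : ℕ)] (g s) x),
    fun j => contDiff_const.mul (contDiff_det_iterate_deriv hg _), fun f _ x => ?_⟩
  simp only [wronskian]
  rw [Matrix.det_succ_column _ (Fin.last N), Fin.sum_univ_castSucc,
    ← Fin.sum_univ_eq_sum_range (fun j => (-1) ^ (j + N) * Matrix.det (Matrix.of fun r s : Fin N =>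
      deriv^[((Fin.ofNat (N + 1) j).succAbove r : ℕ)] (g s) x) * deriv^[j] f x)]
  have hlast : (-1 : ℂ) ^ (N + N) = 1 := by rw [← two_mul]; simp
  simp only [Matrix.of_apply, Fin.val_last, Fin.val_castSucc, Fin.snoc_last, hlast]
  have hof : ∀ j : Fin N, Fin.ofNat (N + 1) (j : ℕ) = j.castSucc := by
    intro j
    ext
    simp [Fin.ofNat, Nat.mod_eq_of_lt (j.isLt.trans (Nat.lt_succ_self N))]
  have hsub : ∀ i : Fin (N + 1), (Matrix.of fun r s : Fin (N + 1) =>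
      deriv^[(r : ℕ)] ((Fin.snoc g f : Fin (N + 1) → ℝ → ℂ) s) x).submatrix i.succAbove
        (Fin.last N).succAbove
      = Matrix.of fun r s : Fin N => deriv^[(i.succAbove r : ℕ)] (g s) x := by
    intro i
    ext r s
    simp
  simp only [hof, hsub]
  simp only [Fin.succAbove_last, Fin.val_castSucc]
  rw [one_mul, mul_comm (deriv^[N] f x), add_sub_cancel_right]
  exact Finset.sum_congr rfl fun j _ => by ring

lemma wronskian_snoc_self {N : ℕ} (g : Fin N → ℝ → ℂ) (s : Fin N) (x : ℝ) :
    wronskian (Fin.snoc g (g s) : Fin (N + 1) → ℝ → ℂ) x = 0 :=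
  Matrix.det_zero_of_column_eq (Fin.castSucc_lt_last s).ne fun r => by simp

lemma iterate_deriv_const_mul' (b : ℂ) (f : ℝ → ℂ) (r : ℕ) :
    deriv^[r] (fun x => b * f x) = fun x => b * deriv^[r] f x := by
  induction r with
  | zero => rfl
  | succ r ih =>
    funext x
    rw [Function.iterate_succ_apply', ih, Function.iterate_succ_apply', deriv_const_mul_field]

lemma wronskian_const_mul {N : ℕ} (b : Fin N → ℂ) (g : Fin N → ℝ → ℂ) (x : ℝ) :
    wronskian (fun s x => b s * g s x) x = (∏ s, b s) * wronskian g x := by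
  rw [wronskian, wronskian, ← Matrix.det_mul_row]
  congr 1
  ext r s
  simp [iterate_deriv_const_mul']

lemma wronskian_snoc_const_mul {N : ℕ} (a b : ℂ) (g : Fin N → ℝ → ℂ) (f : ℝ → ℂ) (x : ℝ) :
    wronskian (Fin.snoc (fun s x => a * g s x) (fun x => b * f x) : Fin (N + 1) → ℝ → ℂ) x
      = a ^ N * b * wronskian (Fin.snoc g f : Fin (N + 1) → ℝ → ℂ) x := by
  have h : (Fin.snoc (fun s x => a * g s x) (fun x => b * f x) : Fin (N + 1) → ℝ → ℂ)
      = fun s x => (Fin.snoc (fun _ => a) b : Fin (N + 1) → ℂ) s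
          * (Fin.snoc g f : Fin (N + 1) → ℝ → ℂ) s x := by
    funext s
    induction s using Fin.lastCases <;> simp
  rw [h, wronskian_const_mul]
  simp [Fin.prod_univ_castSucc]

/-- Adjoining to `g` a function in the kernel of `∂ - u` amounts to applying `∂ - u` to `g`. -/
lemma wronskian_snoc_of_deriv_eq {N : ℕ} {g : Fin N → ℝ → ℂ} {u y : ℝ → ℂ}
    (hg : ∀ s, ContDiff ℝ (⊤ : ℕ∞) (g s)) (hu : ContDiff ℝ (⊤ : ℕ∞) u)
    (hy : ContDiff ℝ (⊤ : ℕ∞) y) (hyu : ∀ x, deriv y x = u x * y x) (x : ℝ) :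
    wronskian (Fin.snoc g y : Fin (N + 1) → ℝ → ℂ) x
      = (-1) ^ N * y x * wronskian (fun s x => deriv (g s) x - u x * g s x) x := by
  rw [← det_eq_wronskian _ (contDiff_snoc hg hy)
    (factoredOp fun j => if j = 0 then u else 0)
    (OrderLT.factoredOp_sub fun j => by split_ifs; exacts [hu, contDiff_const]),
    Matrix.det_succ_column _ (Fin.last N), Fin.sum_univ_succ, Finset.sum_eq_zero, add_zero]
  · simp only [Matrix.of_apply, Fin.val_zero, Fin.val_last, zero_add, Fin.snoc_last, factoredOp]
    congr 1
    rw [wronskian]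
    congr 1
    ext r s
    simp [factoredOp_single]
  · intro i _
    have h0 : (fun x => deriv y x - u x * y x) = fun _ => 0 := by
      funext x
      rw [hyu, sub_self]
    have hz : ∀ r : ℕ, deriv^[r] (fun _ : ℝ => (0 : ℂ)) = fun _ => 0 := by
      intro r
      simpa using iterate_deriv_const_mul' 0 (fun _ => 0) r
    simp [factoredOp_single, h0, hz]

/-- Intertwining of `∂ - u` with the monic operator annihilating `g`, in bilinear form. -/
lemma wronskian_mul_wronskian_deriv_sub {N : ℕ} {g : Fin N → ℝ → ℂ} {u y f : ℝ → ℂ}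
    (hg : ∀ s, ContDiff ℝ (⊤ : ℕ∞) (g s)) (hu : ContDiff ℝ (⊤ : ℕ∞) u)
    (hy : ContDiff ℝ (⊤ : ℕ∞) y) (hyu : ∀ x, deriv y x = u x * y x)
    (hf : ContDiff ℝ (⊤ : ℕ∞) f) {x : ℝ} (hyx : y x ≠ 0)
    (hV : wronskian (fun s x => deriv (g s) x - u x * g s x) x ≠ 0) :
    wronskian g x * wronskian (Fin.snoc (fun s x => deriv (g s) x - u x * g s x)
        (fun x => deriv f x - u x * f x) : Fin (N + 1) → ℝ → ℂ) x
      = wronskian (fun s x => deriv (g s) x - u x * g s x) x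
          * deriv (wronskian (Fin.snoc g f : Fin (N + 1) → ℝ → ℂ)) x
        - u x * wronskian (fun s x => deriv (g s) x - u x * g s x) x
          * wronskian (Fin.snoc g f : Fin (N + 1) → ℝ → ℂ) x
        - deriv (wronskian fun s x => deriv (g s) x - u x * g s x) x
          * wronskian (Fin.snoc g f : Fin (N + 1) → ℝ → ℂ) x := by
  set Dg : Fin N → ℝ → ℂ := fun s x => deriv (g s) x - u x * g s x with hDg
  have hDgs : ∀ s, ContDiff ℝ (⊤ : ℕ∞) (Dg s) := fun s => contDiff_deriv_sub hu (hg s)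
  have hWs := contDiff_wronskian hg
  have hVs := contDiff_wronskian hDgs
  have hP := OrderLT.wronskian_snoc hg
  have hQ := (OrderLT.wronskian_snoc hDgs).comp_deriv_sub hu
  have hW1 : ContDiff ℝ (⊤ : ℕ∞) (deriv (wronskian g)) := hWs.iterate_deriv 1
  have hV1 : ContDiff ℝ (⊤ : ℕ∞) (deriv (wronskian Dg)) := hVs.iterate_deriv 1
  let Φ : (ℝ → ℂ) → ℝ → ℂ := fun f x =>
    wronskian g x * wronskian (Fin.snoc Dg (fun x => deriv f x - u x * f x)
        : Fin (N + 1) → ℝ → ℂ) x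
      - (wronskian Dg x * deriv (wronskian (Fin.snoc g f : Fin (N + 1) → ℝ → ℂ)) x
        - u x * wronskian Dg x * wronskian (Fin.snoc g f : Fin (N + 1) → ℝ → ℂ) x
        - deriv (wronskian Dg) x * wronskian (Fin.snoc g f : Fin (N + 1) → ℝ → ℂ) x)
  have hΦ : OrderLT (N + 1) Φ := by
    have e1 := OrderLT.mul_left (hWs.mul hVs) (OrderLT.iterate_deriv_sub hu N)
    have e2 := OrderLT.mul_left hWs hQ
    have e3 := OrderLT.mul_left (hVs.mul hW1).neg (OrderLT.iterate_deriv N)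
    have e4 := OrderLT.mul_left hVs.neg hP.deriv_comp
    have e5 := OrderLT.mul_left ((hu.mul hVs).add hV1)
      ((OrderLT.mul_left hWs (OrderLT.iterate_deriv N)).add (hP.mono (Nat.le_succ N)))
    refine ((((e1.add e2).add e3).add e4).add e5).congr fun f hf x => ?_
    have hd : deriv (fun x => wronskian (Fin.snoc g f : Fin (N + 1) → ℝ → ℂ) x
          - wronskian g x * deriv^[N] f x) x
        = deriv (wronskian (Fin.snoc g f : Fin (N + 1) → ℝ → ℂ)) x
          - (deriv (wronskian g) x * deriv^[N] f x
            + wronskian g x * deriv^[N + 1] f x) := by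
      have d1 := (contDiff_wronskian (contDiff_snoc hg hf)).differentiable (by simp) x
      have d2 := hWs.differentiable (by simp) x
      have d3 := (hf.iterate_deriv N).differentiable (by simp) x
      rw [deriv_fun_sub d1 (d2.fun_mul d3), deriv_fun_mul d2 d3, Function.iterate_succ_apply']
    simp only [Φ, hd]
    ring
  suffices h : Φ f x = 0 from sub_eq_zero.1 h
  obtain ⟨c, -, hc⟩ := hΦ
  have hcol : ∀ s : Fin (N + 1), Φ ((Fin.snoc g y : Fin (N + 1) → ℝ → ℂ) s) x = 0 := by
    intro s
    induction s using Fin.lastCases with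
    | cast s =>
      have h0 : wronskian (Fin.snoc g (g s) : Fin (N + 1) → ℝ → ℂ) = fun _ => 0 :=
        funext (wronskian_snoc_self g s)
      have h1 := wronskian_snoc_self Dg s x
      simp only [hDg] at h1
      simp [Φ, h0, hDg, h1]
    | last =>
      have h0 : wronskian (Fin.snoc g y : Fin (N + 1) → ℝ → ℂ)
          = fun x => (-1) ^ N * y x * wronskian Dg x :=
        funext (wronskian_snoc_of_deriv_eq hg hu hy hyu)
      have h1 : (fun x => deriv y x - u x * y x) = fun x => 0 * y x := by
        funext x
        rw [hyu, sub_self, zero_mul]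
      have h2 : wronskian (Fin.snoc Dg (fun x => 0 * y x) : Fin (N + 1) → ℝ → ℂ) x = 0 := by
        simpa using wronskian_snoc_const_mul 1 0 Dg y x
      have d1 := (contDiff_const (c := ((-1) ^ N : ℂ)).mul hy).differentiable (by simp) x
      have d2 := hVs.differentiable (by simp) x
      have d3 : deriv (fun x => (-1) ^ N * y x * wronskian Dg x) x
          = (-1) ^ N * (u x * y x) * wronskian Dg x
            + (-1) ^ N * y x * deriv (wronskian Dg) x := by
        rw [deriv_fun_mul d1 d2, deriv_const_mul_field, hyu]
      simp only [Φ, Fin.snoc_last, h0, h1, h2, d3]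
      ring
  have hc0 : (fun r : Fin (N + 1) => c r x) = 0 := by
    refine Matrix.eq_zero_of_vecMul_eq_zero (M := Matrix.of fun r s : Fin (N + 1) =>
      deriv^[(r : ℕ)] ((Fin.snoc g y : Fin (N + 1) → ℝ → ℂ) s) x) ?_ ?_
    · change wronskian (Fin.snoc g y : Fin (N + 1) → ℝ → ℂ) x ≠ 0
      rw [wronskian_snoc_of_deriv_eq hg hu hy hyu]
      exact mul_ne_zero (mul_ne_zero (by simp) hyx) hV
    · funext s
      have h := hcol s
      rw [hc _ (contDiff_snoc hg hy s), ← Fin.sum_univ_eq_sum_range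
        (fun j => c j x * deriv^[j] ((Fin.snoc g y : Fin (N + 1) → ℝ → ℂ) s) x)] at h
      simpa [Matrix.vecMul, dotProduct] using h
  rw [hc f hf, ← Fin.sum_univ_eq_sum_range (fun j => c j x * deriv^[j] f x)]
  exact Finset.sum_eq_zero fun j _ => by rw [congrFun hc0 j, Pi.zero_apply, zero_mul]

/-- The zeroth-order coefficient in `φ_x = a_i φ_i + u_i φ`. -/
def fwdCoeff (a : Fin 3 → ℂ) (τ : (Fin 3 → ℤ) → ℝ → ℂ) (i : Fin 3) (n : Fin 3 → ℤ) (x : ℝ) : ℂ :=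
  deriv (τ (fwd i n)) x / τ (fwd i n) x - deriv (τ n) x / τ n x - a i

/-- An explicit nonvanishing element of the kernel of `∂ - fwdCoeff a τ i n`. -/
def fwdKer (a : Fin 3 → ℂ) (τ : (Fin 3 → ℤ) → ℝ → ℂ) (i : Fin 3) (n : Fin 3 → ℤ) (x : ℝ) : ℂ :=
  τ (fwd i n) x / τ n x * Complex.exp (-a i * x)

lemma wr_eq_wronskian {N : ℕ} (θ : Fin N → (Fin 3 → ℤ) → ℝ → ℂ) (n : Fin 3 → ℤ) :
    Wr θ n = wronskian fun s => θ s n := rfl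

lemma wr_snoc_eq_wronskian {N : ℕ} (θ : Fin N → (Fin 3 → ℤ) → ℝ → ℂ)
    (φ : (Fin 3 → ℤ) → ℝ → ℂ) (n : Fin 3 → ℤ) :
    Wr (Fin.snoc θ φ : Fin (N + 1) → (Fin 3 → ℤ) → ℝ → ℂ) n
      = wronskian (Fin.snoc (fun s => θ s n) (φ n) : Fin (N + 1) → ℝ → ℂ) := by
  rw [wr_eq_wronskian]
  congr 1
  funext s
  induction s using Fin.lastCases <;> simp

section Lattice

variable {a : Fin 3 → ℂ} {τ : (Fin 3 → ℤ) → ℝ → ℂ}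

lemma contDiff_fwdCoeff (hτ0 : ∀ n x, τ n x ≠ 0) (hτ : ∀ n, ContDiff ℝ (⊤ : ℕ∞) (τ n))
    (i : Fin 3) (n : Fin 3 → ℤ) : ContDiff ℝ (⊤ : ℕ∞) (fwdCoeff a τ i n) :=
by
  unfold fwdCoeff
  simp only [div_eq_mul_inv]
  exact ((((hτ _).iterate_deriv 1).mul ((hτ _).inv (hτ0 _))).sub
    (((hτ _).iterate_deriv 1).mul ((hτ _).inv (hτ0 _)))).sub contDiff_const

lemma contDiff_fwdKer (hτ0 : ∀ n x, τ n x ≠ 0) (hτ : ∀ n, ContDiff ℝ (⊤ : ℕ∞) (τ n))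
    (i : Fin 3) (n : Fin 3 → ℤ) : ContDiff ℝ (⊤ : ℕ∞) (fwdKer a τ i n) :=
by
  unfold fwdKer
  simp only [div_eq_mul_inv]
  exact ((hτ _).mul ((hτ _).inv (hτ0 _))).mul
    (contDiff_const.mul Complex.ofRealCLM.contDiff).cexp

lemma fwdKer_ne_zero (hτ0 : ∀ n x, τ n x ≠ 0) (i : Fin 3) (n : Fin 3 → ℤ) (x : ℝ) :
    fwdKer a τ i n x ≠ 0 :=
  mul_ne_zero (div_ne_zero (hτ0 _ _) (hτ0 _ _)) (Complex.exp_ne_zero _)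

lemma deriv_fwdKer (hτ0 : ∀ n x, τ n x ≠ 0) (hτ : ∀ n, ContDiff ℝ (⊤ : ℕ∞) (τ n))
    (i : Fin 3) (n : Fin 3 → ℤ) (x : ℝ) :
    deriv (fwdKer a τ i n) x = fwdCoeff a τ i n x * fwdKer a τ i n x := by
  have hd : ∀ m, HasDerivAt (τ m) (deriv (τ m) x) x := fun m =>
    ((hτ m).differentiable (by simp) x).hasDerivAt
  have he : HasDerivAt (fun x : ℝ => Complex.exp (-a i * x))
      (Complex.exp (-a i * x) * (-a i * 1)) x :=
    ((Complex.ofRealCLM.hasDerivAt (x := x)).const_mul (-a i)).cexp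
  have h : HasDerivAt (fwdKer a τ i n) _ x := ((hd (fwd i n)).div (hd n) (hτ0 n x)).mul he
  rw [h.deriv, fwdCoeff, fwdKer]
  have h1 := hτ0 n x
  have h2 := hτ0 (fwd i n) x
  simp only [Pi.div_apply]
  field_simp
  ring

lemma SemiKP.deriv_fwdKer_sub (hτ0 : ∀ n x, τ n x ≠ 0)
    (hτ : ∀ n, ContDiff ℝ (⊤ : ℕ∞) (τ n)) (hKP : SemiKP a τ) {i j : Fin 3} (hij : i < j)
    (n : Fin 3 → ℤ) (x : ℝ) :
    deriv (fwdKer a τ i n) x - fwdCoeff a τ j n x * fwdKer a τ i n x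
      = (a j - a i) * fwdKer a τ i (fwd j n) x := by
  rw [deriv_fwdKer hτ0 hτ]
  simp only [fwdKer, fwdCoeff]
  have h := hKP i j hij n x
  have h0 := hτ0 n x
  have h1 := hτ0 (fwd i n) x
  have h2 := hτ0 (fwd j n) x
  field_simp
  linear_combination τ n x * h

lemma FwdLin.deriv_sub {φ : (Fin 3 → ℤ) → ℝ → ℂ} (hφ : FwdLin a τ φ) (i : Fin 3)
    (n : Fin 3 → ℤ) (x : ℝ) :
    deriv (φ n) x - fwdCoeff a τ i n x * φ n x = a i * φ (fwd i n) x := by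
  rw [hφ.2 i n x, fwdCoeff]
  ring

variable {N : ℕ} {θ : Fin N → (Fin 3 → ℤ) → ℝ → ℂ}

lemma wronskian_deriv_sub_fwdCoeff (hθ : ∀ s, FwdLin a τ (θ s)) (i : Fin 3) (n : Fin 3 → ℤ) :
    wronskian (fun s x => deriv (θ s n) x - fwdCoeff a τ i n x * θ s n x)
      = fun x => a i ^ N * Wr θ (fwd i n) x := by
  funext x
  simp only [(hθ _).deriv_sub, wr_eq_wronskian]
  rw [wronskian_const_mul (fun _ => a i) fun s => θ s (fwd i n)]
  simp

lemma wronskian_snoc_fwdKer (hτ0 : ∀ n x, τ n x ≠ 0) (hτ : ∀ n, ContDiff ℝ (⊤ : ℕ∞) (τ n))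
    (hθs : ∀ s n, ContDiff ℝ (⊤ : ℕ∞) (θ s n)) (hθ : ∀ s, FwdLin a τ (θ s)) (i : Fin 3)
    (n : Fin 3 → ℤ) :
    wronskian (Fin.snoc (fun s => θ s n) (fwdKer a τ i n) : Fin (N + 1) → ℝ → ℂ)
      = fun x => (-1) ^ N * a i ^ N * (fwdKer a τ i n x * Wr θ (fwd i n) x) := by
  funext x
  rw [wronskian_snoc_of_deriv_eq (fun s => hθs s n) (contDiff_fwdCoeff hτ0 hτ i n)
    (contDiff_fwdKer hτ0 hτ i n) (deriv_fwdKer hτ0 hτ i n), wronskian_deriv_sub_fwdCoeff hθ]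
  ring

/-- The bilinear form of the Darboux transformation for the pair `(f, g)` with
`(∂ - u_k) f = b g`. -/
lemma wr_mul_wronskian_snoc_fwd (ha : ∀ i, a i ≠ 0) (hτ0 : ∀ n x, τ n x ≠ 0)
    (hτ : ∀ n, ContDiff ℝ (⊤ : ℕ∞) (τ n)) (hθs : ∀ s n, ContDiff ℝ (⊤ : ℕ∞) (θ s n))
    (hθ : ∀ s, FwdLin a τ (θ s)) (hW0 : ∀ n x, Wr θ n x ≠ 0) (k : Fin 3) (n : Fin 3 → ℤ)
    {f g : ℝ → ℂ} {b : ℂ} (hf : ContDiff ℝ (⊤ : ℕ∞) f)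
    (hfg : ∀ x, deriv f x - fwdCoeff a τ k n x * f x = b * g x) (x : ℝ) :
    b * Wr θ n x * wronskian (Fin.snoc (fun s => θ s (fwd k n)) g : Fin (N + 1) → ℝ → ℂ) x
      = Wr θ (fwd k n) x
          * deriv (wronskian (Fin.snoc (fun s => θ s n) f : Fin (N + 1) → ℝ → ℂ)) x
        - fwdCoeff a τ k n x * Wr θ (fwd k n) x
          * wronskian (Fin.snoc (fun s => θ s n) f : Fin (N + 1) → ℝ → ℂ) x
        - deriv (Wr θ (fwd k n)) x
          * wronskian (Fin.snoc (fun s => θ s n) f : Fin (N + 1) → ℝ → ℂ) x := by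
  have hak : a k ^ N ≠ 0 := pow_ne_zero _ (ha k)
  have h := wronskian_mul_wronskian_deriv_sub (fun s => hθs s n)
    (contDiff_fwdCoeff hτ0 hτ k n) (contDiff_fwdKer hτ0 hτ k n) (deriv_fwdKer hτ0 hτ k n) hf
    (fwdKer_ne_zero hτ0 k n x)
    (by rw [wronskian_deriv_sub_fwdCoeff hθ]; exact mul_ne_zero hak (hW0 _ _))
  rw [wronskian_deriv_sub_fwdCoeff hθ] at h
  simp only [(hθ _).deriv_sub, hfg] at h
  rw [wronskian_snoc_const_mul (a k) b fun s => θ s (fwd k n), deriv_const_mul_field,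
    ← wr_eq_wronskian] at h
  apply mul_left_cancel₀ hak
  linear_combination h

lemma wr_eq_cas (hτ0 : ∀ n x, τ n x ≠ 0)
    (hτ : ∀ n, ContDiff ℝ (⊤ : ℕ∞) (τ n)) (hθs : ∀ s n, ContDiff ℝ (⊤ : ℕ∞) (θ s n))
    (hθ : ∀ s, FwdLin a τ (θ s)) (k : Fin 3) (n : Fin 3 → ℤ) (x : ℝ) :
    Wr θ n x = a k ^ (N * (N - 1) / 2) * Cas k θ n x := by
  have hop : ∀ (r : ℕ) (s : Fin N),
      factoredOp (fun r => fwdCoeff a τ k ((fwd k)^[r] n)) r (θ s n)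
        = fun x => a k ^ r * θ s ((fwd k)^[r] n) x := by
    intro r s
    induction r with
    | zero => simp [factoredOp]
    | succ r ih =>
      funext x
      simp only [factoredOp, ih]
      rw [deriv_const_mul_field, Function.iterate_succ_apply', pow_succ,
        mul_assoc, ← (hθ s).deriv_sub]
      ring
  rw [wr_eq_wronskian, ← det_eq_wronskian _ (fun s => hθs s n)
    (factoredOp fun r => fwdCoeff a τ k ((fwd k)^[r] n))
    (OrderLT.factoredOp_sub fun r => contDiff_fwdCoeff hτ0 hτ k _)]
  simp only [hop]
  rw [Cas, ← Finset.sum_range_id, ← Finset.prod_pow_eq_pow_sum,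
    ← Fin.prod_univ_eq_prod_range (fun r => a k ^ r), ← Matrix.det_mul_column]
  rfl

lemma SemiKP.darboux (ha : ∀ i, a i ≠ 0) (hτ0 : ∀ n x, τ n x ≠ 0)
    (hτ : ∀ n, ContDiff ℝ (⊤ : ℕ∞) (τ n)) (hKP : SemiKP a τ)
    (hθs : ∀ s n, ContDiff ℝ (⊤ : ℕ∞) (θ s n))
    (hθ : ∀ s, FwdLin a τ (θ s)) (hW0 : ∀ n x, Wr θ n x ≠ 0) :
    SemiKP a (fun n x => Wr θ n x * τ n x) := by
  intro i j hij n x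
  have hW : ∀ m, DifferentiableAt ℝ (Wr θ m) x := fun m =>
    (contDiff_wronskian fun s => hθs s m).differentiable (by simp) x
  have hd : ∀ m, DifferentiableAt ℝ (τ m) x := fun m => (hτ m).differentiable (by simp) x
  have h := wr_mul_wronskian_snoc_fwd ha hτ0 hτ hθs hθ hW0 j n (contDiff_fwdKer hτ0 hτ i n)
    (hKP.deriv_fwdKer_sub hτ0 hτ hij n) x
  have hy := (contDiff_fwdKer (a := a) hτ0 hτ i n).differentiable (by simp) x
  rw [wronskian_snoc_fwdKer hτ0 hτ hθs hθ, wronskian_snoc_fwdKer hτ0 hτ hθs hθ,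
    deriv_const_mul_field, deriv_fun_mul hy (hW _), deriv_fwdKer hτ0 hτ] at h
  have hε : (-1 : ℂ) ^ N * a i ^ N ≠ 0 := mul_ne_zero (by simp) (pow_ne_zero _ (ha i))
  have h' := mul_left_cancel₀ hε (b := (a j - a i) * Wr θ n x
      * (fwdKer a τ i (fwd j n) x * Wr θ (fwd i (fwd j n)) x))
    (c := Wr θ (fwd j n) x * (fwdCoeff a τ i n x * fwdKer a τ i n x * Wr θ (fwd i n) x
        + fwdKer a τ i n x * deriv (Wr θ (fwd i n)) x)
      - fwdCoeff a τ j n x * Wr θ (fwd j n) x * (fwdKer a τ i n x * Wr θ (fwd i n) x)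
      - deriv (Wr θ (fwd j n)) x * (fwdKer a τ i n x * Wr θ (fwd i n) x))
    (by linear_combination h)
  rw [deriv_fun_mul (hW _) (hd _), deriv_fun_mul (hW _) (hd _)]
  simp only [fwdKer, fwdCoeff] at h'
  have h0 := hτ0 n x
  have h1 := hτ0 (fwd i n) x
  have h2 := hτ0 (fwd j n) x
  have he := Complex.exp_ne_zero (-a i * x)
  field_simp at h'
  apply mul_left_cancel₀ h0
  linear_combination -h'

lemma FwdLin.darboux (ha : ∀ i, a i ≠ 0) (hτ0 : ∀ n x, τ n x ≠ 0)
    (hτ : ∀ n, ContDiff ℝ (⊤ : ℕ∞) (τ n)) (hKP : SemiKP a τ)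
    (hθs : ∀ s n, ContDiff ℝ (⊤ : ℕ∞) (θ s n))
    (hθ : ∀ s, FwdLin a τ (θ s)) (hW0 : ∀ n x, Wr θ n x ≠ 0)
    {φ : (Fin 3 → ℤ) → ℝ → ℂ} (hφs : ∀ n, ContDiff ℝ (⊤ : ℕ∞) (φ n)) (hφ : FwdLin a τ φ) :
    FwdLin a (fun n x => Wr θ n x * τ n x) (fun n x =>
      Wr (Fin.snoc θ φ : Fin (N + 1) → (Fin 3 → ℤ) → ℝ → ℂ) n x / Wr θ n x) := by
  have hW : ∀ m x, DifferentiableAt ℝ (Wr θ m) x := fun m x =>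
    (contDiff_wronskian fun s => hθs s m).differentiable (by simp) x
  have hd : ∀ m x, DifferentiableAt ℝ (τ m) x := fun m x =>
    (hτ m).differentiable (by simp) x
  have hx : ∀ i n x, deriv (fun x =>
      Wr (Fin.snoc θ φ : Fin (N + 1) → (Fin 3 → ℤ) → ℝ → ℂ) n x / Wr θ n x) x
      = a i * (Wr (Fin.snoc θ φ : Fin (N + 1) → (Fin 3 → ℤ) → ℝ → ℂ) (fwd i n) x
          / Wr θ (fwd i n) x)
        + (deriv (fun x => Wr θ (fwd i n) x * τ (fwd i n) x) x
            / (Wr θ (fwd i n) x * τ (fwd i n) x)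
          - deriv (fun x => Wr θ n x * τ n x) x / (Wr θ n x * τ n x) - a i)
          * (Wr (Fin.snoc θ φ : Fin (N + 1) → (Fin 3 → ℤ) → ℝ → ℂ) n x / Wr θ n x) := by
    intro i n x
    have h := wr_mul_wronskian_snoc_fwd ha hτ0 hτ hθs hθ hW0 i n (hφs n) (hφ.deriv_sub i n) x
    have hWφ : DifferentiableAt ℝ
        (Wr (Fin.snoc θ φ : Fin (N + 1) → (Fin 3 → ℤ) → ℝ → ℂ) n) x := by
      rw [wr_snoc_eq_wronskian]
      exact (contDiff_wronskian (contDiff_snoc (fun s => hθs s n) (hφs n))).differentiable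
        (by simp) x
    rw [← wr_snoc_eq_wronskian, ← wr_snoc_eq_wronskian, fwdCoeff] at h
    rw [deriv_fun_div hWφ (hW _ _) (hW0 _ _), deriv_fun_mul (hW _ _) (hd _ _),
      deriv_fun_mul (hW _ _) (hd _ _)]
    have h0 := hτ0 n x
    have h1 := hτ0 (fwd i n) x
    have h2 := hW0 n x
    have h3 := hW0 (fwd i n) x
    field_simp at h ⊢
    linear_combination -Wr θ n x * h
  refine ⟨fun i j hij n x => ?_, hx⟩
  have hi := hx i n x
  have hj := hx j n x
  have hkp := SemiKP.darboux ha hτ0 hτ hKP hθs hθ hW0 i j hij n x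
  have hT0 : ∀ m, Wr θ m x * τ m x ≠ 0 := fun m => mul_ne_zero (hW0 m x) (hτ0 m x)
  have hquot : (a i - a j) * (Wr θ (fwd i (fwd j n)) x * τ (fwd i (fwd j n)) x
        * (Wr θ n x * τ n x)
        / (Wr θ (fwd i n) x * τ (fwd i n) x * (Wr θ (fwd j n) x * τ (fwd j n) x)))
      = (a i - a j) - deriv (fun x => Wr θ (fwd i n) x * τ (fwd i n) x) x
            / (Wr θ (fwd i n) x * τ (fwd i n) x)
        + deriv (fun x => Wr θ (fwd j n) x * τ (fwd j n) x) x
            / (Wr θ (fwd j n) x * τ (fwd j n) x) := by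
    have h1 := hT0 (fwd i n)
    have h2 := hT0 (fwd j n)
    dsimp only at hkp
    generalize Wr θ (fwd i n) x * τ (fwd i n) x = A at *
    generalize Wr θ (fwd j n) x * τ (fwd j n) x = B at *
    field_simp
    linear_combination hkp
  dsimp only
  rw [hquot]
  linear_combination hj - hi

end Lattice

/-- N-fold Darboux transformation in Wronskian form: if `θ_1, …, θ_N, φ` solve the forward
linear system with potential `τ` and the Wronskian `W = W(θ_1,…,θ_N)` is nowhere zero, then
(a) `τ[N] = W·τ` and `φ[N] = Ŵ/W` (with `Ŵ = W(θ_1,…,θ_N,φ)`) satisfy the forward linear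
system with potential `τ[N]`, and `τ[N]` satisfies the semi-discrete KP equation;
(b) in each lattice direction `k`, `W = a_k^{N(N−1)/2}·Cas_N` and `Ŵ = a_k^{N(N+1)/2}·Cas_{N+1}`,
the Casoratians taken with forward shifts in direction `k`. -/
theorem darboux_hirota_miwa_N_fold_wronskian
    (N : ℕ) (a : Fin 3 → ℂ) (ha : ∀ i, a i ≠ 0)
    (τ : (Fin 3 → ℤ) → ℝ → ℂ)
    (hτ0 : ∀ n x, τ n x ≠ 0)
    (hτsmooth : ∀ n, ContDiff ℝ (⊤ : ℕ∞) (τ n))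
    (hKP : SemiKP a τ)
    (θ : Fin N → (Fin 3 → ℤ) → ℝ → ℂ) (φ : (Fin 3 → ℤ) → ℝ → ℂ)
    (hθsmooth : ∀ s n, ContDiff ℝ (⊤ : ℕ∞) (θ s n))
    (hφsmooth : ∀ n, ContDiff ℝ (⊤ : ℕ∞) (φ n))
    (hθ : ∀ s, FwdLin a τ (θ s)) (hφ : FwdLin a τ φ)
    (hW0 : ∀ n x, Wr θ n x ≠ 0) :
    (SemiKP a (fun n x => Wr θ n x * τ n x)
      ∧ FwdLin a (fun n x => Wr θ n x * τ n x)
          (fun n x => Wr (Fin.snoc θ φ) n x / Wr θ n x))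
    ∧ (∀ k : Fin 3, ∀ n x,
        Wr θ n x = a k ^ (N * (N - 1) / 2) * Cas k θ n x
        ∧ Wr (Fin.snoc θ φ) n x = a k ^ (N * (N + 1) / 2) * Cas k (Fin.snoc θ φ) n x) := by
  have hsnoc_smooth : ∀ s n, ContDiff ℝ (⊤ : ℕ∞)
      ((Fin.snoc θ φ : Fin (N + 1) → (Fin 3 → ℤ) → ℝ → ℂ) s n) := by
    intro s n
    induction s using Fin.lastCases with
    | last => simpa using hφsmooth n
    | cast s => simpa using hθsmooth s n
  have hsnoc : ∀ s, FwdLin a τ ((Fin.snoc θ φ : Fin (N + 1) → (Fin 3 → ℤ) → ℝ → ℂ) s) := by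
    intro s
    induction s using Fin.lastCases with
    | last => simpa using hφ
    | cast s => simpa using hθ s
  refine ⟨⟨hKP.darboux ha hτ0 hτsmooth hθsmooth hθ hW0,
    hφ.darboux ha hτ0 hτsmooth hKP hθsmooth hθ hW0 hφsmooth⟩, fun k n x =>
    ⟨wr_eq_cas hτ0 hτsmooth hθsmooth hθ k n x, ?_⟩⟩
  have h := wr_eq_cas hτ0 hτsmooth hsnoc_smooth hsnoc k n x
  rwa [Nat.add_sub_cancel, mul_comm (N + 1) N] at h
end
end

section
/- (Compatibility of the potential ω: continuous versus discrete.) Let a_1, a_2, a_3 be nonzero complex numbers and let τ : ℤ³ × ℝ → ℂ be nowhere vanishing and smooth in x. Let φ be a smooth solution of the forward linear system with potential τ and ψ a smooth solution of the backward linear system with potential τ. Then for each i = 1,2,3, ∂_x(φ·ψ_i) = a_i((φψ)_i − φψ); in other words, the defining relations Δ_iω = φψ_i and ω_x = φψ for the potential ω(φ,ψ) (where Δ_i = a_i(T_i − 1)) are compatible. -/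
noncomputable section

theorem bwd_fwd (i : Fin 3) (n : Fin 3 → ℤ) : bwd i (fwd i n) = n := by
  simp [bwd, fwd]

/-- Compatibility of the potential `ω`: continuous versus discrete. If `φ` solves the
forward and `ψ` the backward linear system with potential `τ`, then for each `i`,
`∂_x(φ·ψ_i) = a_i((φψ)_i − φψ)`, i.e. the defining relations `Δ_i ω = φ ψ_i` and
`ω_x = φψ` for the potential `ω(φ,ψ)` are compatible. -/
theorem omega_compatibility_continuous_discrete
    (a : Fin 3 → ℂ) (ha : ∀ i, a i ≠ 0)
    (τ φ ψ : (Fin 3 → ℤ) → ℝ → ℂ)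
    (hτ0 : ∀ n x, τ n x ≠ 0)
    (hτsmooth : ∀ n, ContDiff ℝ (⊤ : ℕ∞) (τ n))
    (hφsmooth : ∀ n, ContDiff ℝ (⊤ : ℕ∞) (φ n))
    (hψsmooth : ∀ n, ContDiff ℝ (⊤ : ℕ∞) (ψ n))
    (hφ : FwdLin a τ φ) (hψ : BwdLin a τ ψ) :
    ∀ i : Fin 3, ∀ n x,
      deriv (fun y => φ n y * ψ (fwd i n) y) x
        = a i * (φ (fwd i n) x * ψ (fwd i n) x - φ n x * ψ n x) := by
  intro i n x
  have h1 := hφ.2 i n x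
  have h2 := hψ.2 i (fwd i n) x
  rw [bwd_fwd] at h2
  have d1 := (hφsmooth n).differentiable (by simp) x
  have d2 := (hψsmooth (fwd i n)).differentiable (by simp) x
  have h := (d1.hasDerivAt.mul d2.hasDerivAt).deriv
  refine h.trans ?_
  rw [h1, h2]
  ring
end
end

section
/- (2-reduction of the Hirota–Miwa equation to the dKdV equation.) Let a_1, a_2 be complex numbers with a_1 + a_2 ≠ 0, and let τ : ℤ² → ℂ be nowhere vanishing and satisfy the bilinear equation (a_2 − a_1)τ_{12}τ_2̄ + (a_1 + a_2)τ_{12̄}τ_2 = 2a_2 τ τ_1 at every lattice point. Then the function u := τ_1 τ_2̄/(τ_{12̄} τ) is nowhere zero and satisfies the discrete KdV equation 1/u_1 − 1/u_2 = ((a_1 − a_2)/(a_1 + a_2))(u_{12} − u) at every lattice point, equivalently (a_1 + a_2)(u_2 − u_1) = (a_1 − a_2)(u_{12} − u) u_1 u_2. -/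
noncomputable section

/-- The nonlinear variable `u = τ_1 τ_2̄ / (τ_{12̄} τ)` of the 2-reduction. -/
def uof (τ : ℤ → ℤ → ℂ) (n₁ n₂ : ℤ) : ℂ :=
  τ (n₁ + 1) n₂ * τ n₁ (n₂ - 1) / (τ (n₁ + 1) (n₂ - 1) * τ n₁ n₂)

/-- Nowhere vanishing of `τ` makes `u` nowhere zero. -/
theorem uof_ne_zero {τ : ℤ → ℤ → ℂ} (hτ0 : ∀ n₁ n₂, τ n₁ n₂ ≠ 0) (n₁ n₂ : ℤ) :
    uof τ n₁ n₂ ≠ 0 :=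
  div_ne_zero (mul_ne_zero (hτ0 _ _) (hτ0 _ _)) (mul_ne_zero (hτ0 _ _) (hτ0 _ _))

/-- The bilinear equation at `(n₁ + 1, n₂)`, in terms of `u_1` and `u_{12}`. -/
theorem inv_uof_fst_sub_uof_fst_snd
    {a₁ a₂ : ℂ} {τ : ℤ → ℤ → ℂ} (hτ0 : ∀ n₁ n₂, τ n₁ n₂ ≠ 0)
    (hbil : ∀ n₁ n₂ : ℤ,
      (a₂ - a₁) * (τ (n₁ + 1) (n₂ + 1) * τ n₁ (n₂ - 1))
        + (a₁ + a₂) * (τ (n₁ + 1) (n₂ - 1) * τ n₁ (n₂ + 1))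
        = 2 * a₂ * (τ n₁ n₂ * τ (n₁ + 1) n₂))
    (n₁ n₂ : ℤ) :
    (a₁ + a₂) * (uof τ (n₁ + 1) n₂)⁻¹ - (a₁ - a₂) * uof τ (n₁ + 1) (n₂ + 1)
      = 2 * a₂ * τ (n₁ + 1) n₂ ^ 2 / (τ (n₁ + 1) (n₂ - 1) * τ (n₁ + 1) (n₂ + 1)) := by
  have h := hbil (n₁ + 1) n₂
  have h₁ := hτ0 (n₁ + 1) n₂
  have h₂ := hτ0 (n₁ + 1) (n₂ - 1)
  have h₃ := hτ0 (n₁ + 1) (n₂ + 1)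
  have h₄ := hτ0 (n₁ + 1 + 1) n₂
  have h₅ := hτ0 (n₁ + 1 + 1) (n₂ - 1)
  simp only [uof, add_sub_cancel_right]
  field_simp
  linear_combination h

/-- The bilinear equation at `(n₁, n₂)`, in terms of `u_2` and `u`. -/
theorem inv_uof_snd_sub_uof
    {a₁ a₂ : ℂ} {τ : ℤ → ℤ → ℂ} (hτ0 : ∀ n₁ n₂, τ n₁ n₂ ≠ 0)
    (hbil : ∀ n₁ n₂ : ℤ,
      (a₂ - a₁) * (τ (n₁ + 1) (n₂ + 1) * τ n₁ (n₂ - 1))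
        + (a₁ + a₂) * (τ (n₁ + 1) (n₂ - 1) * τ n₁ (n₂ + 1))
        = 2 * a₂ * (τ n₁ n₂ * τ (n₁ + 1) n₂))
    (n₁ n₂ : ℤ) :
    (a₁ + a₂) * (uof τ n₁ (n₂ + 1))⁻¹ - (a₁ - a₂) * uof τ n₁ n₂
      = 2 * a₂ * τ (n₁ + 1) n₂ ^ 2 / (τ (n₁ + 1) (n₂ - 1) * τ (n₁ + 1) (n₂ + 1)) := by
  have h := hbil n₁ n₂
  have h₁ := hτ0 (n₁ + 1) n₂
  have h₂ := hτ0 (n₁ + 1) (n₂ - 1)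
  have h₃ := hτ0 (n₁ + 1) (n₂ + 1)
  have h₄ := hτ0 n₁ n₂
  have h₅ := hτ0 n₁ (n₂ + 1)
  simp only [uof, add_sub_cancel_right]
  field_simp
  linear_combination h

/-- 2-reduction of the Hirota–Miwa equation to the dKdV equation: if `τ` is nowhere
vanishing and satisfies the bilinear equation
`(a_2 − a_1) τ_{12} τ_2̄ + (a_1 + a_2) τ_{12̄} τ_2 = 2 a_2 τ τ_1`, then
`u = τ_1 τ_2̄/(τ_{12̄} τ)` is nowhere zero and satisfies the discrete KdV equation
`1/u_1 − 1/u_2 = ((a_1 − a_2)/(a_1 + a_2))(u_{12} − u)`, equivalently (without division)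
`(a_1 + a_2)(u_2 − u_1) = (a_1 − a_2)(u_{12} − u) u_1 u_2`. -/
theorem dKdV_of_bilinear
    (a₁ a₂ : ℂ) (ha : a₁ + a₂ ≠ 0)
    (τ : ℤ → ℤ → ℂ) (hτ0 : ∀ n₁ n₂, τ n₁ n₂ ≠ 0)
    (hbil : ∀ n₁ n₂ : ℤ,
      (a₂ - a₁) * (τ (n₁ + 1) (n₂ + 1) * τ n₁ (n₂ - 1))
        + (a₁ + a₂) * (τ (n₁ + 1) (n₂ - 1) * τ n₁ (n₂ + 1))
        = 2 * a₂ * (τ n₁ n₂ * τ (n₁ + 1) n₂)) :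
    (∀ n₁ n₂ : ℤ, uof τ n₁ n₂ ≠ 0)
    ∧ (∀ n₁ n₂ : ℤ,
        1 / uof τ (n₁ + 1) n₂ - 1 / uof τ n₁ (n₂ + 1)
          = (a₁ - a₂) / (a₁ + a₂) * (uof τ (n₁ + 1) (n₂ + 1) - uof τ n₁ n₂))
    ∧ (∀ n₁ n₂ : ℤ,
        (a₁ + a₂) * (uof τ n₁ (n₂ + 1) - uof τ (n₁ + 1) n₂)
          = (a₁ - a₂) * (uof τ (n₁ + 1) (n₂ + 1) - uof τ n₁ n₂)
              * (uof τ (n₁ + 1) n₂ * uof τ n₁ (n₂ + 1))) := by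
  have hdiff (n₁ n₂ : ℤ) :
      (a₁ + a₂) * ((uof τ (n₁ + 1) n₂)⁻¹ - (uof τ n₁ (n₂ + 1))⁻¹)
        = (a₁ - a₂) * (uof τ (n₁ + 1) (n₂ + 1) - uof τ n₁ n₂) := by
    linear_combination inv_uof_fst_sub_uof_fst_snd hτ0 hbil n₁ n₂
      - inv_uof_snd_sub_uof hτ0 hbil n₁ n₂
  refine ⟨uof_ne_zero hτ0, fun n₁ n₂ => ?_, fun n₁ n₂ => ?_⟩
  · rw [one_div, one_div, div_mul_eq_mul_div, eq_div_iff ha, ← hdiff, mul_comm]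
  · have h₁ := uof_ne_zero hτ0 (n₁ + 1) n₂
    have h₂ := uof_ne_zero hτ0 n₁ (n₂ + 1)
    rw [← hdiff]
    field_simp
end
end

section
/- (Darboux transformation for the dKdV equation, Proposition 4.) Let a_1, a_2 be nonzero complex numbers and λ ∈ ℂ. Let τ : ℤ² × ℝ → ℂ be nowhere vanishing, smooth in x, and satisfy the three 2-reduced semi-discrete KP equations: (a_1−a_2)(τ_{12}τ − τ_1τ_2) + τ_{1,x}τ_2 − τ_1τ_{2,x} = 0; (a_1+a_2)(τ_{12̄}τ − τ_1τ_2̄) + τ_{1,x}τ_2̄ − τ_1τ_{2̄,x} = 0; and 2a_2(τ² − τ_2τ_2̄) + τ_{2,x}τ_2̄ − τ_2τ_{2̄,x} = 0, at every lattice point and every x. Set u := τ_1τ_2̄/(τ_{12̄}τ). Let θ and φ be smooth solutions of the dKdV forward Lax system with data (u, τ), with θ nowhere vanishing. Define τ̃ := θτ, ũ := u·θ_1θ_2̄/(θ_{12̄}θ), and φ̃ := φ_x − (θ_x/θ)φ. Then ũ = τ̃_1τ̃_2̄/(τ̃_{12̄}τ̃), φ̃ = a_i(φ_i − (θ_i/θ)φ)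 for i = 1,2, τ̃ satisfies the same three bilinear equations, and φ̃ satisfies the dKdV forward Lax system with data (ũ, τ̃). -/
noncomputable section

/-- The three 2-reduced semi-discrete KP bilinear equations:
`(a₁−a₂)(τ_{12}τ − τ_1τ_2) + τ_{1,x}τ_2 − τ_1τ_{2,x} = 0`,
`(a₁+a₂)(τ_{12̄}τ − τ_1τ_2̄) + τ_{1,x}τ_2̄ − τ_1τ_{2̄,x} = 0`, and
`2a₂(τ² − τ_2τ_2̄) + τ_{2,x}τ_2̄ − τ_2τ_{2̄,x} = 0`. -/
def Bilin2 (a₁ a₂ : ℂ) (τ : ℤ → ℤ → ℝ → ℂ) : Prop :=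
  ∀ n₁ n₂ : ℤ, ∀ x : ℝ,
    ((a₁ - a₂) * (τ (n₁+1) (n₂+1) x * τ n₁ n₂ x - τ (n₁+1) n₂ x * τ n₁ (n₂+1) x)
      + deriv (τ (n₁+1) n₂) x * τ n₁ (n₂+1) x - τ (n₁+1) n₂ x * deriv (τ n₁ (n₂+1)) x = 0)
    ∧ ((a₁ + a₂) * (τ (n₁+1) (n₂-1) x * τ n₁ n₂ x - τ (n₁+1) n₂ x * τ n₁ (n₂-1) x)
      + deriv (τ (n₁+1) n₂) x * τ n₁ (n₂-1) x - τ (n₁+1) n₂ x * deriv (τ n₁ (n₂-1)) x = 0)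
    ∧ (2 * a₂ * (τ n₁ n₂ x ^ 2 - τ n₁ (n₂+1) x * τ n₁ (n₂-1) x)
      + deriv (τ n₁ (n₂+1)) x * τ n₁ (n₂-1) x - τ n₁ (n₂+1) x * deriv (τ n₁ (n₂-1)) x = 0)

/-- The dKdV forward Lax system for `φ` with data `(u, τ)` and spectral parameter `λ`:
`a₁φ_1 − a₂φ_2 = (a₁−a₂)u_2 φ`; `a₁φ_1 + a₂(1−λ²)φ_2̄ = (a₁+a₂)(1/u)φ`;
`φ_x = a_iφ_i + ((τ_x/τ)_i − τ_x/τ − a_i)φ` for `i = 1,2`; and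
`φ_x = −a₂(1−λ²)φ_2̄ + ((τ_x/τ)_2̄ − τ_x/τ + a₂)φ`. -/
def LaxF (a₁ a₂ lam : ℂ) (u τ φ : ℤ → ℤ → ℝ → ℂ) : Prop :=
  ∀ n₁ n₂ : ℤ, ∀ x : ℝ,
    (a₁ * φ (n₁+1) n₂ x - a₂ * φ n₁ (n₂+1) x = (a₁ - a₂) * u n₁ (n₂+1) x * φ n₁ n₂ x)
    ∧ (a₁ * φ (n₁+1) n₂ x + a₂ * (1 - lam^2) * φ n₁ (n₂-1) x
        = (a₁ + a₂) * (1 / u n₁ n₂ x) * φ n₁ n₂ x)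
    ∧ (deriv (φ n₁ n₂) x = a₁ * φ (n₁+1) n₂ x
        + (deriv (τ (n₁+1) n₂) x / τ (n₁+1) n₂ x
            - deriv (τ n₁ n₂) x / τ n₁ n₂ x - a₁) * φ n₁ n₂ x)
    ∧ (deriv (φ n₁ n₂) x = a₂ * φ n₁ (n₂+1) x
        + (deriv (τ n₁ (n₂+1)) x / τ n₁ (n₂+1) x
            - deriv (τ n₁ n₂) x / τ n₁ n₂ x - a₂) * φ n₁ n₂ x)
    ∧ (deriv (φ n₁ n₂) x = -(a₂ * (1 - lam^2)) * φ n₁ (n₂-1) x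
        + (deriv (τ n₁ (n₂-1)) x / τ n₁ (n₂-1) x
            - deriv (τ n₁ n₂) x / τ n₁ n₂ x + a₂) * φ n₁ n₂ x)

lemma logDeriv_sub_logDeriv_eq_iff {k w p q p' q' : ℂ} (hp : p ≠ 0) (hq : q ≠ 0) :
    k * (w - p * q) + p' * q - p * q' = 0 ↔ p' / p - q' / q = k * (1 - w / (p * q)) := by
  rw [div_sub_div _ _ hp hq, one_sub_div (mul_ne_zero hp hq), ← mul_div_assoc,
    div_left_inj' (mul_ne_zero hp hq)]
  constructor <;> intro h <;> linear_combination h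

lemma deriv_mul_div_mul {f g : ℝ → ℂ} {x : ℝ} (hf : DifferentiableAt ℝ f x)
    (hg : DifferentiableAt ℝ g x) (hf0 : f x ≠ 0) (hg0 : g x ≠ 0) :
    deriv (fun y => f y * g y) x / (f x * g x) = deriv f x / f x + deriv g x / g x := by
  rw [deriv_fun_mul hf hg]
  field_simp

/-- If `θ` and `φ` solve the same linear equation `φ_x = cφ_s + Lφ`, then `φ_x − (θ_x/θ)φ = c(φ_s − (θ_s/θ)φ)`. -/
lemma darboux_eq_shift {c L p p' ps q q' qs : ℂ} (hq0 : q ≠ 0)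
    (hp : p' = c * ps + L * p) (hq : q' = c * qs + L * q) :
    p' - q' / q * p = c * (ps - qs / q * p) := by
  rw [hp, hq]
  field_simp
  ring

/-- The Darboux transform of a solution `φ` of `φ_x = cφ_s + ((τ_x/τ)_s − τ_x/τ − a)φ` by a
nonvanishing solution `θ` solves the equation with `τ` replaced by `θτ`. -/
lemma deriv_darboux {c a : ℂ} {τ τs θ θs φ φs : ℝ → ℂ}
    (hτ : Differentiable ℝ τ) (hτs : Differentiable ℝ τs)
    (hθ : Differentiable ℝ θ) (hθs : Differentiable ℝ θs)
    (hφ : Differentiable ℝ φ) (hφs : Differentiable ℝ φs)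
    (hτ0 : ∀ x, τ x ≠ 0) (hτs0 : ∀ x, τs x ≠ 0) (hθ0 : ∀ x, θ x ≠ 0) (hθs0 : ∀ x, θs x ≠ 0)
    (hθeq : ∀ x, deriv θ x = c * θs x + (deriv τs x / τs x - deriv τ x / τ x - a) * θ x)
    (hφeq : ∀ x, deriv φ x = c * φs x + (deriv τs x / τs x - deriv τ x / τ x - a) * φ x)
    (x : ℝ) :
    deriv (fun y => deriv φ y - deriv θ y / θ y * φ y) x
      = c * (deriv φs x - deriv θs x / θs x * φs x)
        + (deriv (fun y => θs y * τs y) x / (θs x * τs x)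
            - deriv (fun y => θ y * τ y) x / (θ x * τ x) - a)
          * (deriv φ x - deriv θ x / θ x * φ x) := by
  have key : (fun y => deriv φ y - deriv θ y / θ y * φ y)
      = fun y => c * (φs y - θs y / θ y * φ y) := by
    funext y
    exact darboux_eq_shift (hθ0 y) (hφeq y) (hθeq y)
  have hd := ((hφs x).hasDerivAt.sub
    (((hθs x).hasDerivAt.div (hθ x).hasDerivAt (hθ0 x)).mul (hφ x).hasDerivAt)).const_mul c
  rw [key, deriv_mul_div_mul (hθs x) (hτs x) (hθs0 x) (hτs0 x),
    deriv_mul_div_mul (hθ x) (hτ x) (hθ0 x) (hτ0 x)]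
  refine hd.deriv.trans ?_
  have hθM : deriv θ x / θ x = c * (θs x / θ x) + (deriv τs x / τs x - deriv τ x / τ x - a) := by
    rw [hθeq x]
    field_simp [hθ0 x]
  have h1 : (deriv θs x * θ x - θs x * deriv θ x) / θ x ^ 2
      = θs x / θ x * (deriv θs x / θs x - deriv θ x / θ x) := by
    have := hθ0 x
    have := hθs0 x
    field_simp
  have h2 := darboux_eq_shift (hθ0 x) (hφeq x) (hθeq x)
  simp only [Pi.div_apply, h1]
  generalize deriv θ x / θ x = M at *
  generalize deriv θs x / θs x = Ms at *
  generalize θs x / θ x = r at *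
  generalize deriv τs x / τs x = Ls at *
  generalize deriv τ x / τ x = L at *
  linear_combination (-(c * r)) * h2 + c * (φs x - r * φ x) * hθM
    - (Ms + Ls - (M + L) - a) * h2

/-- Darboux transformation for the dKdV equation (Proposition 4): with `τ` nowhere
vanishing solving the three 2-reduced bilinear equations, `u = τ_1τ_2̄/(τ_{12̄}τ)`, and
`θ, φ` solutions of the dKdV forward Lax system with data `(u, τ)`, `θ` nowhere zero, the
functions `τ̃ = θτ`, `ũ = u·θ_1θ_2̄/(θ_{12̄}θ)` and `φ̃ = φ_x − (θ_x/θ)φ` satisfy: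
`ũ = τ̃_1τ̃_2̄/(τ̃_{12̄}τ̃)`; `φ̃ = a_i(φ_i − (θ_i/θ)φ)` for `i = 1,2`; `τ̃` solves the
same three bilinear equations; and `φ̃` solves the dKdV forward Lax system with data
`(ũ, τ̃)`. -/
theorem darboux_dKdV
    (a₁ a₂ lam : ℂ) (ha₁ : a₁ ≠ 0) (ha₂ : a₂ ≠ 0)
    (τ θ φ : ℤ → ℤ → ℝ → ℂ)
    (hτ0 : ∀ n₁ n₂ x, τ n₁ n₂ x ≠ 0)
    (hτsmooth : ∀ n₁ n₂, ContDiff ℝ (⊤ : ℕ∞) (τ n₁ n₂))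
    (hτbil : Bilin2 a₁ a₂ τ)
    (hθsmooth : ∀ n₁ n₂, ContDiff ℝ (⊤ : ℕ∞) (θ n₁ n₂))
    (hφsmooth : ∀ n₁ n₂, ContDiff ℝ (⊤ : ℕ∞) (φ n₁ n₂))
    (hθ : LaxF a₁ a₂ lam
      (fun n₁ n₂ x => τ (n₁+1) n₂ x * τ n₁ (n₂-1) x / (τ (n₁+1) (n₂-1) x * τ n₁ n₂ x)) τ θ)
    (hφ : LaxF a₁ a₂ lam
      (fun n₁ n₂ x => τ (n₁+1) n₂ x * τ n₁ (n₂-1) x / (τ (n₁+1) (n₂-1) x * τ n₁ n₂ x)) τ φ)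
    (hθ0 : ∀ n₁ n₂ x, θ n₁ n₂ x ≠ 0) :
    (∀ n₁ n₂ : ℤ, ∀ x : ℝ,
      τ (n₁+1) n₂ x * τ n₁ (n₂-1) x / (τ (n₁+1) (n₂-1) x * τ n₁ n₂ x)
          * (θ (n₁+1) n₂ x * θ n₁ (n₂-1) x / (θ (n₁+1) (n₂-1) x * θ n₁ n₂ x))
        = (θ (n₁+1) n₂ x * τ (n₁+1) n₂ x) * (θ n₁ (n₂-1) x * τ n₁ (n₂-1) x)
            / ((θ (n₁+1) (n₂-1) x * τ (n₁+1) (n₂-1) x) * (θ n₁ n₂ x * τ n₁ n₂ x)))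
    ∧ (∀ n₁ n₂ : ℤ, ∀ x : ℝ,
      deriv (φ n₁ n₂) x - deriv (θ n₁ n₂) x / θ n₁ n₂ x * φ n₁ n₂ x
        = a₁ * (φ (n₁+1) n₂ x - θ (n₁+1) n₂ x / θ n₁ n₂ x * φ n₁ n₂ x)
      ∧ deriv (φ n₁ n₂) x - deriv (θ n₁ n₂) x / θ n₁ n₂ x * φ n₁ n₂ x
        = a₂ * (φ n₁ (n₂+1) x - θ n₁ (n₂+1) x / θ n₁ n₂ x * φ n₁ n₂ x))
    ∧ Bilin2 a₁ a₂ (fun n₁ n₂ x => θ n₁ n₂ x * τ n₁ n₂ x)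
    ∧ LaxF a₁ a₂ lam
        (fun n₁ n₂ x =>
          τ (n₁+1) n₂ x * τ n₁ (n₂-1) x / (τ (n₁+1) (n₂-1) x * τ n₁ n₂ x)
            * (θ (n₁+1) n₂ x * θ n₁ (n₂-1) x / (θ (n₁+1) (n₂-1) x * θ n₁ n₂ x)))
        (fun n₁ n₂ x => θ n₁ n₂ x * τ n₁ n₂ x)
        (fun n₁ n₂ x =>
          deriv (φ n₁ n₂) x - deriv (θ n₁ n₂) x / θ n₁ n₂ x * φ n₁ n₂ x) := by
  have dτ : ∀ n₁ n₂, Differentiable ℝ (τ n₁ n₂) := fun n₁ n₂ =>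
    (hτsmooth n₁ n₂).differentiable (by simp)
  have dθ : ∀ n₁ n₂, Differentiable ℝ (θ n₁ n₂) := fun n₁ n₂ =>
    (hθsmooth n₁ n₂).differentiable (by simp)
  have dφ : ∀ n₁ n₂, Differentiable ℝ (φ n₁ n₂) := fun n₁ n₂ =>
    (hφsmooth n₁ n₂).differentiable (by simp)
  have hprod : ∀ n₁ n₂ x, θ n₁ n₂ x * τ n₁ n₂ x ≠ 0 := fun n₁ n₂ x =>
    mul_ne_zero (hθ0 n₁ n₂ x) (hτ0 n₁ n₂ x)
  have hlog : ∀ n₁ n₂ x, deriv (fun y => θ n₁ n₂ y * τ n₁ n₂ y) x / (θ n₁ n₂ x * τ n₁ n₂ x)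
      = deriv (θ n₁ n₂) x / θ n₁ n₂ x + deriv (τ n₁ n₂) x / τ n₁ n₂ x := fun n₁ n₂ x =>
    deriv_mul_div_mul (dθ n₁ n₂ x) (dτ n₁ n₂ x) (hθ0 n₁ n₂ x) (hτ0 n₁ n₂ x)
  have hM1 : ∀ n₁ n₂ x, deriv (θ n₁ n₂) x / θ n₁ n₂ x + deriv (τ n₁ n₂) x / τ n₁ n₂ x
      = a₁ * θ (n₁+1) n₂ x / θ n₁ n₂ x + deriv (τ (n₁+1) n₂) x / τ (n₁+1) n₂ x - a₁ := by
    intro n₁ n₂ x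
    rw [(hθ n₁ n₂ x).2.2.1, add_div, mul_div_cancel_right₀ _ (hθ0 n₁ n₂ x)]
    ring
  have hM2 : ∀ n₁ n₂ x, deriv (θ n₁ n₂) x / θ n₁ n₂ x + deriv (τ n₁ n₂) x / τ n₁ n₂ x
      = a₂ * θ n₁ (n₂+1) x / θ n₁ n₂ x + deriv (τ n₁ (n₂+1)) x / τ n₁ (n₂+1) x - a₂ := by
    intro n₁ n₂ x
    rw [(hθ n₁ n₂ x).2.2.2.1, add_div, mul_div_cancel_right₀ _ (hθ0 n₁ n₂ x)]
    ring
  have hM3 : ∀ n₁ n₂ x, deriv (θ n₁ n₂) x / θ n₁ n₂ x + deriv (τ n₁ n₂) x / τ n₁ n₂ x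
      = -(a₂ * (1 - lam^2)) * θ n₁ (n₂-1) x / θ n₁ n₂ x
        + deriv (τ n₁ (n₂-1)) x / τ n₁ (n₂-1) x + a₂ := by
    intro n₁ n₂ x
    rw [(hθ n₁ n₂ x).2.2.2.2, add_div, mul_div_cancel_right₀ _ (hθ0 n₁ n₂ x)]
    ring
  have hbil : Bilin2 a₁ a₂ (fun n₁ n₂ x => θ n₁ n₂ x * τ n₁ n₂ x) := by
    intro n₁ n₂ x
    have t00 := hτ0 n₁ n₂ x
    have t10 := hτ0 (n₁+1) n₂ x
    have t01 := hτ0 n₁ (n₂+1) x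
    have t0m := hτ0 n₁ (n₂-1) x
    have t1m := hτ0 (n₁+1) (n₂-1) x
    have q00 := hθ0 n₁ n₂ x
    have q10 := hθ0 (n₁+1) n₂ x
    have q01 := hθ0 n₁ (n₂+1) x
    have q0m := hθ0 n₁ (n₂-1) x
    refine ⟨?_, ?_, ?_⟩
    · rw [logDeriv_sub_logDeriv_eq_iff (hprod _ _ x) (hprod _ _ x), hlog, hlog,
        hM2 (n₁+1) n₂ x, hM1 n₁ (n₂+1) x]
      have h := (hθ n₁ n₂ x).1
      simp only [add_sub_cancel_right] at h
      field_simp at h ⊢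
      linear_combination (-θ (n₁+1) (n₂+1) x) * h
    · rw [logDeriv_sub_logDeriv_eq_iff (hprod _ _ x) (hprod _ _ x), hlog, hlog,
        hM3 (n₁+1) n₂ x, hM1 n₁ (n₂-1) x]
      have h := (hθ n₁ n₂ x).2.1
      field_simp at h ⊢
      linear_combination (-τ (n₁+1) (n₂-1) x * θ (n₁+1) (n₂-1) x) * h
    · have h2 := hM3 n₁ (n₂+1) x
      have h3 := hM2 n₁ (n₂-1) x
      simp only [add_sub_cancel_right, sub_add_cancel] at h2 h3
      have hb := (logDeriv_sub_logDeriv_eq_iff t01 t0m).1 (hτbil n₁ n₂ x).2.2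
      have h45 := (hθ n₁ n₂ x).2.2.2.1.symm.trans (hθ n₁ n₂ x).2.2.2.2
      have h : a₂ * θ n₁ (n₂+1) x + a₂ * (1 - lam^2) * θ n₁ (n₂-1) x
          = 2 * a₂ * (τ n₁ n₂ x ^ 2 / (τ n₁ (n₂+1) x * τ n₁ (n₂-1) x)) * θ n₁ n₂ x := by
        linear_combination h45 - θ n₁ n₂ x * hb
      rw [logDeriv_sub_logDeriv_eq_iff (hprod _ _ x) (hprod _ _ x), hlog, hlog, h2, h3]
      field_simp at h ⊢
      linear_combination (-a₂ * τ n₁ n₂ x * θ n₁ n₂ x) * h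
  refine ⟨?_, ?_, hbil, ?_⟩
  · intro n₁ n₂ x
    rw [div_mul_div_comm]
    congr 1 <;> ring
  · intro n₁ n₂ x
    exact ⟨darboux_eq_shift (hθ0 n₁ n₂ x) (hφ n₁ n₂ x).2.2.1 (hθ n₁ n₂ x).2.2.1,
      darboux_eq_shift (hθ0 n₁ n₂ x) (hφ n₁ n₂ x).2.2.2.1 (hθ n₁ n₂ x).2.2.2.1⟩
  · intro n₁ n₂ x
    have d1 := deriv_darboux (dτ n₁ n₂) (dτ (n₁+1) n₂) (dθ n₁ n₂) (dθ (n₁+1) n₂) (dφ n₁ n₂)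
      (dφ (n₁+1) n₂) (hτ0 _ _) (hτ0 _ _) (hθ0 _ _) (hθ0 _ _)
      (fun x => (hθ n₁ n₂ x).2.2.1) (fun x => (hφ n₁ n₂ x).2.2.1) x
    have d2 := deriv_darboux (dτ n₁ n₂) (dτ n₁ (n₂+1)) (dθ n₁ n₂) (dθ n₁ (n₂+1)) (dφ n₁ n₂)
      (dφ n₁ (n₂+1)) (hτ0 _ _) (hτ0 _ _) (hθ0 _ _) (hθ0 _ _)
      (fun x => (hθ n₁ n₂ x).2.2.2.1) (fun x => (hφ n₁ n₂ x).2.2.2.1) x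
    have d3 := deriv_darboux (c := -(a₂ * (1 - lam^2))) (a := -a₂)
      (dτ n₁ n₂) (dτ n₁ (n₂-1)) (dθ n₁ n₂) (dθ n₁ (n₂-1)) (dφ n₁ n₂) (dφ n₁ (n₂-1)) (hτ0 _ _) (hτ0 _ _) (hθ0 _ _) (hθ0 _ _)
      (fun x => (hθ n₁ n₂ x).2.2.2.2.trans (by ring))
      (fun x => (hφ n₁ n₂ x).2.2.2.2.trans (by ring)) x
    have b1 := (logDeriv_sub_logDeriv_eq_iff (hprod _ _ x) (hprod _ _ x)).1 (hbil n₁ n₂ x).1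
    have b2 := (logDeriv_sub_logDeriv_eq_iff (hprod _ _ x) (hprod _ _ x)).1 (hbil n₁ n₂ x).2.1
    refine ⟨?_, ?_, d1, d2, d3.trans (by ring)⟩
    · have hu : τ (n₁+1) (n₂+1) x * τ n₁ n₂ x / (τ (n₁+1) n₂ x * τ n₁ (n₂+1) x)
            * (θ (n₁+1) (n₂+1) x * θ n₁ n₂ x / (θ (n₁+1) n₂ x * θ n₁ (n₂+1) x))
          = θ (n₁+1) (n₂+1) x * τ (n₁+1) (n₂+1) x * (θ n₁ n₂ x * τ n₁ n₂ x)
            / (θ (n₁+1) n₂ x * τ (n₁+1) n₂ x * (θ n₁ (n₂+1) x * τ n₁ (n₂+1) x)) := by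
        rw [div_mul_div_comm]
        congr 1 <;> ring
      simp only [add_sub_cancel_right]
      rw [hu]
      linear_combination d2 - d1 - (deriv (φ n₁ n₂) x
        - deriv (θ n₁ n₂) x / θ n₁ n₂ x * φ n₁ n₂ x) * b1
    · have hu : 1 / (τ (n₁+1) n₂ x * τ n₁ (n₂-1) x / (τ (n₁+1) (n₂-1) x * τ n₁ n₂ x)
            * (θ (n₁+1) n₂ x * θ n₁ (n₂-1) x / (θ (n₁+1) (n₂-1) x * θ n₁ n₂ x)))
          = θ (n₁+1) (n₂-1) x * τ (n₁+1) (n₂-1) x * (θ n₁ n₂ x * τ n₁ n₂ x)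
            / (θ (n₁+1) n₂ x * τ (n₁+1) n₂ x * (θ n₁ (n₂-1) x * τ n₁ (n₂-1) x)) := by
        rw [div_mul_div_comm, one_div_div]
        congr 1 <;> ring
      simp only [hu]
      linear_combination d3 - d1 - (deriv (φ n₁ n₂) x
        - deriv (θ n₁ n₂) x / θ n₁ n₂ x * φ n₁ n₂ x) * b2
end
end
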